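/- Let R be a Noetherian ring and I an ideal of R. Then for each finitely generated R-module M with q(I, M) ≤ 1 (i.e., H^i_I(M) is Artinian for all i ≥ 2), the R-modules H^i_I(M) are I-cofinite for all i ≥ 0. -/

import Mathlib

universe u

open CategoryTheory

/-- An `R`-module `L` is `I`-cofinite if `Supp L ⊆ V(I)` and `Ext^i_R(R/I, L)` is a finitely
generated `R`-module for all `i ≥ 0`. -/
def IsCofinite {R : Type u} [CommRing R] (I : Ideal R) (L : ModuleCat.{u} R) : Prop :=
  Module.support R L ⊆ PrimeSpectrum.zeroLocus (I : Set R) ∧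
    ∀ i : ℕ, Module.Finite R
      (((Ext R (ModuleCat.{u} R) i).obj (Opposite.op (ModuleCat.of R (R ⧸ I)))).obj L)

section ExtCompare
open CategoryTheory.Abelian CategoryTheory.Limits

variable {R : Type u} [CommRing R]

lemma extMk_zero_iff' {X Y : ModuleCat.{u} R} (P : ProjectiveResolution X)
    (f : P.complex.X 0 ⟶ Y) (hf : P.complex.d 1 0 ≫ f = 0) :
    P.extMk f 1 rfl hf = 0 ↔ f = 0 := by
  constructor
  · intro h
    rw [← P.extEquivCohomologyClass.apply_eq_iff_eq,
      ProjectiveResolution.extEquivCohomologyClass_extMk,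
      ProjectiveResolution.extEquivCohomologyClass_zero,
      CochainComplex.HomComplex.CohomologyClass.mk_eq_zero_iff,
      CochainComplex.HomComplex.Cocycle.toSingleMk_mem_coboundaries_iff _ _ _ _ _ 1 (by simp)] at h
    obtain ⟨g, hg⟩ := h
    have h1 : g = 0 := by
      apply IsZero.eq_of_src
      exact P.cochainComplex.isZero_of_isStrictlyLE 0 1
    rw [h1, comp_zero] at hg
    rw [← cancel_epi (P.cochainComplexXIso (-(0:ℕ)) 0 rfl).hom]
    simpa using hg.symm
  · rintro rfl
    simp

/-- cocycles -/
def cocyc {X : ModuleCat.{u} R} (P : ProjectiveResolution X) (Y : ModuleCat.{u} R) (n : ℕ) :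
    Submodule R (P.complex.X n ⟶ Y) where
  carrier := {f | P.complex.d (n+1) n ≫ f = 0}
  add_mem' {a b} ha hb := by
    simp only [Set.mem_ofPred_eq] at *
    rw [Preadditive.comp_add, ha, hb, add_zero]
  zero_mem' := by simp
  smul_mem' r a ha := by
    simp only [Set.mem_ofPred_eq] at *
    rw [Linear.comp_smul, ha, smul_zero]

lemma mem_cocyc {X : ModuleCat.{u} R} (P : ProjectiveResolution X) (Y : ModuleCat.{u} R) (n : ℕ)
    (f : P.complex.X n ⟶ Y) : f ∈ cocyc P Y n ↔ P.complex.d (n+1) n ≫ f = 0 := Iff.rfl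

noncomputable def newMk {X : ModuleCat.{u} R} (P : ProjectiveResolution X) (Y : ModuleCat.{u} R) (n : ℕ) :
    cocyc P Y n →ₗ[R] Abelian.Ext X Y n where
  toFun f := P.extMk f.1 (n+1) rfl ((mem_cocyc P Y n _).1 f.2)
  map_add' f g := by
    rw [P.add_extMk _ _ _ _ ((mem_cocyc P Y n _).1 f.2) ((mem_cocyc P Y n _).1 g.2)]; rfl
  map_smul' r f := by
    rw [Abelian.Ext.smul_eq_comp_mk₀, P.extMk_comp_mk₀]
    simp

lemma newMk_surj {X : ModuleCat.{u} R} (P : ProjectiveResolution X) (Y : ModuleCat.{u} R) (n : ℕ) :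
    Function.Surjective (newMk P Y n) := by
  intro x
  obtain ⟨f, hf, h⟩ := P.extMk_surjective x (n+1) rfl
  exact ⟨⟨f, hf⟩, h⟩

abbrev Fop (Y : ModuleCat.{u} R) : ModuleCat.{u} R ⥤ (ModuleCat.{u} R)ᵒᵖ :=
  ((linearYoneda R (ModuleCat.{u} R)).obj Y).rightOp

abbrev Kop {X : ModuleCat.{u} R} (P : ProjectiveResolution X) (Y : ModuleCat.{u} R) :
    ChainComplex (ModuleCat.{u} R)ᵒᵖ ℕ :=
  ((Fop Y).mapHomologicalComplex _).obj P.complex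

/-- opcycles as a module mapping to morphisms -/
noncomputable def zι {X : ModuleCat.{u} R} (P : ProjectiveResolution X) (Y : ModuleCat.{u} R) (n : ℕ) :
    ((Kop P Y).opcycles n).unop →ₗ[R] (P.complex.X n ⟶ Y) :=
  ((Kop P Y).pOpcycles n).unop.hom

noncomputable def isoL {X : ModuleCat.{u} R} (P : ProjectiveResolution X) (Y : ModuleCat.{u} R) (n : ℕ) :
    ((Fop Y).leftDerived n).obj X ≅ (Kop P Y).homology n := P.isoLeftDerivedObj (Fop Y) n

lemma isoL_nat {X X' : ModuleCat.{u} R} (f : X' ⟶ X) (Y : ModuleCat.{u} R) (n : ℕ)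
    (P' : ProjectiveResolution X') (P : ProjectiveResolution X) (φ : P'.complex ⟶ P.complex)
    (hφ : φ.f 0 ≫ P.π.f 0 = P'.π.f 0 ≫ f) :
    ((Fop Y).leftDerived n).map f ≫ (isoL P Y n).hom = (isoL P' Y n).hom ≫
      HomologicalComplex.homologyMap (((Fop Y).mapHomologicalComplex _).map φ : Kop P' Y ⟶ Kop P Y) n :=
  ProjectiveResolution.isoLeftDerivedObj_hom_naturality f P' P φ hφ (Fop Y) n

noncomputable def zq {X : ModuleCat.{u} R} (P : ProjectiveResolution X) (Y : ModuleCat.{u} R) (n : ℕ) :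
    ((Kop P Y).opcycles n).unop →ₗ[R] (((Ext R (ModuleCat.{u} R) n).obj (Opposite.op X)).obj Y) :=
  ((isoL P Y n).hom ≫ (Kop P Y).homologyι n).unop.hom

lemma zι_inj {X : ModuleCat.{u} R} (P : ProjectiveResolution X) (Y : ModuleCat.{u} R) (n : ℕ) :
    Function.Injective (zι P Y n) := by
  have : Mono ((Kop P Y).pOpcycles n).unop := inferInstance
  exact (ModuleCat.mono_iff_injective _).1 this

lemma zq_surj {X : ModuleCat.{u} R} (P : ProjectiveResolution X) (Y : ModuleCat.{u} R) (n : ℕ) :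
    Function.Surjective (zq P Y n) := by
  have h0 : Mono ((isoL P Y n).hom ≫ (Kop P Y).homologyι n) := mono_comp _ _
  have : Epi ((isoL P Y n).hom ≫ (Kop P Y).homologyι n).unop :=
    unop_epi_of_mono _
  exact (ModuleCat.epi_iff_surjective _).1 this

lemma Kop_d {X : ModuleCat.{u} R} (P : ProjectiveResolution X) (Y : ModuleCat.{u} R) (i j : ℕ)
    (f : P.complex.X j ⟶ Y) :
    ((Kop P Y).d i j).unop.hom f = P.complex.d i j ≫ f := rfl

lemma zι_mem {X : ModuleCat.{u} R} (P : ProjectiveResolution X) (Y : ModuleCat.{u} R) (n : ℕ) (z) :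
    zι P Y n z ∈ cocyc P Y n := by
  have h := (Kop P Y).d_pOpcycles (n+1) n
  have h2 := congrArg (fun t => t.unop.hom z) h
  exact h2

lemma zι_range {X : ModuleCat.{u} R} (P : ProjectiveResolution X) (Y : ModuleCat.{u} R) (n : ℕ)
    (f : P.complex.X n ⟶ Y) (hf : f ∈ cocyc P Y n) : ∃ z, zι P Y n z = f := by
  let k : (Kop P Y).X n ⟶ Opposite.op (ModuleCat.of R R) :=
    (ModuleCat.ofHom (LinearMap.toSpanSingleton R (P.complex.X n ⟶ Y) f)).op
  have hk : (Kop P Y).d (n+1) n ≫ k = 0 := by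
    apply Quiver.Hom.unop_inj
    ext
    change (((Kop P Y).d (n+1) n).unop.hom (LinearMap.toSpanSingleton R (P.complex.X n ⟶ Y) f 1)) = 0
    rw [LinearMap.toSpanSingleton_apply, one_smul]
    exact hf
  let e := (Kop P Y).descOpcycles k (n+1) (by simp) hk
  refine ⟨e.unop.hom (1 : R), ?_⟩
  have := (Kop P Y).p_descOpcycles k (n+1) (by simp) hk
  have h2 := congrArg (fun t => t.unop.hom (1:R)) this
  change ((Kop P Y).pOpcycles n).unop.hom (e.unop.hom (1 : R)) = _
  refine h2.trans ?_
  change LinearMap.toSpanSingleton R (P.complex.X n ⟶ Y) f 1 = f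
  simp

lemma zq_ker {X : ModuleCat.{u} R} (P : ProjectiveResolution X) (Y : ModuleCat.{u} R) (n : ℕ) (z) :
    zq P Y n z = 0 ↔ newMk P Y n ⟨zι P Y n z, zι_mem P Y n z⟩ = 0 := by
  have hiso : zq P Y n z = 0 ↔ ((Kop P Y).homologyι n).unop.hom z = 0 := by
    change ((isoL P Y n).hom.unop.hom (((Kop P Y).homologyι n).unop.hom z)) = 0 ↔ _
    have hm : Mono (isoL P Y n).hom.unop := inferInstance
    have := (ModuleCat.mono_iff_injective _).1 hm
    constructor
    · intro h
      exact this (h.trans (map_zero _).symm)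
    · intro h
      rw [h, map_zero]
  rw [hiso]
  cases n with
  | zero =>
    have h1 := extMk_zero_iff' P (zι P Y 0 z) ((mem_cocyc P Y 0 _).1 (zι_mem P Y 0 z))
    refine Iff.trans ?_ h1.symm
    have hm : Mono ((Kop P Y).homologyι 0).unop := inferInstance
    have := (ModuleCat.mono_iff_injective _).1 hm
    constructor
    · intro h
      have : z = 0 := this (h.trans (map_zero _).symm)
      rw [this, map_zero]
    · intro h
      have : z = 0 := zι_inj P Y 0 (h.trans (map_zero _).symm)
      rw [this, map_zero]
  | succ m =>
    have h1 := P.extMk_eq_zero_iff (zι P Y (m+1) z) (m+2) rfl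
      ((mem_cocyc P Y (m+1) _).1 (zι_mem P Y (m+1) z)) m rfl
    refine Iff.trans ?_ h1.symm
    let S : ShortComplex (ModuleCat.{u} R)ᵒᵖ := ShortComplex.mk ((Kop P Y).homologyι (m+1))
      ((Kop P Y).fromOpcycles (m+1) m) (by simp)
    have hS : S.Exact := ShortComplex.exact_of_f_is_kernel S
      ((Kop P Y).homologyIsKernel (m+1) m (by simp))
    have hS2 := hS.unop
    rw [ShortComplex.moduleCat_exact_iff] at hS2
    have hfac : ∀ g : P.complex.X m ⟶ Y,
        zι P Y (m+1) (((Kop P Y).fromOpcycles (m+1) m).unop.hom g) = P.complex.d (m+1) m ≫ g := by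
      intro g
      have := (Kop P Y).p_fromOpcycles (m+1) m
      exact congrArg (fun t => t.unop.hom g) this
    constructor
    · intro h
      obtain ⟨g, hg⟩ := hS2 z h
      refine ⟨g, ?_⟩
      exact (hfac g).symm.trans (congrArg (zι P Y (m+1)) hg)
    · rintro ⟨g, hg⟩
      rw [← hfac] at hg
      have hz := zι_inj P Y (m+1) hg
      rw [← hz]
      have := (Kop P Y).homologyι_comp_fromOpcycles (m+1) m
      exact congrArg (fun t => t.unop.hom g) this

noncomputable def zΘ {X : ModuleCat.{u} R} (P : ProjectiveResolution X) (Y : ModuleCat.{u} R) (n : ℕ) :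
    ((Kop P Y).opcycles n).unop →ₗ[R] Abelian.Ext X Y n :=
  newMk P Y n ∘ₗ (zι P Y n).codRestrict (cocyc P Y n) (zι_mem P Y n)

lemma zΘ_surj {X : ModuleCat.{u} R} (P : ProjectiveResolution X) (Y : ModuleCat.{u} R) (n : ℕ) :
    Function.Surjective (zΘ P Y n) := by
  intro x
  obtain ⟨f, rfl⟩ := newMk_surj P Y n x
  obtain ⟨z, hz⟩ := zι_range P Y n f.1 f.2
  exact ⟨z, congrArg (newMk P Y n) (Subtype.ext hz)⟩

lemma zΘ_ker {X : ModuleCat.{u} R} (P : ProjectiveResolution X) (Y : ModuleCat.{u} R) (n : ℕ) :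
    (zq P Y n).ker = (zΘ P Y n).ker := by
  ext z
  rw [LinearMap.mem_ker, LinearMap.mem_ker]
  exact zq_ker P Y n z

/-- Comparison of the two `Ext`s. -/
noncomputable def extCmp (X Y : ModuleCat.{u} R) (n : ℕ) :
    (((Ext R (ModuleCat.{u} R) n).obj (Opposite.op X)).obj Y) ≃ₗ[R] Abelian.Ext X Y n :=
  ((zq (projectiveResolution X) Y n).quotKerEquivOfSurjective (zq_surj _ Y n)).symm.trans
    ((Submodule.quotEquivOfEq _ _ (zΘ_ker (projectiveResolution X) Y n)).trans
    ((zΘ (projectiveResolution X) Y n).quotKerEquivOfSurjective (zΘ_surj _ Y n)))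

lemma extCmp_zq (X Y : ModuleCat.{u} R) (n : ℕ) (z) :
    extCmp X Y n (zq (projectiveResolution X) Y n z) = zΘ (projectiveResolution X) Y n z := by
  have : ((zq (projectiveResolution X) Y n).quotKerEquivOfSurjective (zq_surj _ Y n)).symm
      (zq (projectiveResolution X) Y n z) = Submodule.Quotient.mk z := by
    rw [LinearEquiv.symm_apply_eq]
    rfl
  simp only [extCmp, LinearEquiv.trans_apply, this]
  rfl


section nat
variable {X X' : ModuleCat.{u} R} (f : X' ⟶ X) (Y : ModuleCat.{u} R) (n : ℕ)
    (P' : ProjectiveResolution X') (P : ProjectiveResolution X) (φ : P'.complex ⟶ P.complex)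
    (hφ : φ.f 0 ≫ P.π.f 0 = P'.π.f 0 ≫ f)

noncomputable def psi : Kop P' Y ⟶ Kop P Y := ((Fop Y).mapHomologicalComplex _).map φ

lemma zcat (hφ : φ.f 0 ≫ P.π.f 0 = P'.π.f 0 ≫ f) :
    ((Fop Y).leftDerived n).map f ≫ ((isoL P Y n).hom ≫ (Kop P Y).homologyι n)
       = ((isoL P' Y n).hom ≫ (Kop P' Y).homologyι n) ≫
         HomologicalComplex.opcyclesMap (psi Y P' P φ) n := by
  have e1 := isoL_nat f Y n P' P φ hφ
  have e2 := HomologicalComplex.homologyι_naturality (psi Y P' P φ) n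
  rw [Category.assoc, ← e2, ← Category.assoc, ← Category.assoc, e1]
  rfl

lemma zq_nat (hφ : φ.f 0 ≫ P.π.f 0 = P'.π.f 0 ≫ f) (z) :
    (((Ext R (ModuleCat.{u} R) n).map f.op).app Y).hom (zq P Y n z) =
      zq P' Y n ((HomologicalComplex.opcyclesMap (psi Y P' P φ) n).unop.hom z) := by
  have e3 := zcat f Y n P' P φ hφ
  have e4 := congrArg (fun t => t.unop) e3
  have e5 := congrArg (fun t => t.hom z) e4
  exact e5

lemma zι_nat (z) : zι P' Y n ((HomologicalComplex.opcyclesMap (psi Y P' P φ) n).unop.hom z)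
    = φ.f n ≫ zι P Y n z := by
  have := HomologicalComplex.p_opcyclesMap (psi Y P' P φ) n
  exact congrArg (fun t => t.unop.hom z) this

lemma newMk_nat (hφ : φ.f 0 ≫ P.π.f 0 = P'.π.f 0 ≫ f) (g : P.complex.X n ⟶ Y)
    (hg : g ∈ cocyc P Y n) (g' : P'.complex.X n ⟶ Y) (hg' : g' ∈ cocyc P' Y n) (h : g' = φ.f n ≫ g) :
    newMk P' Y n ⟨g', hg'⟩ = (Abelian.Ext.mk₀ f).comp (newMk P Y n ⟨g, hg⟩) (zero_add n) := by
  subst h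
  have hφ' : φ.f 0 ≫ P.π.f 0 = P'.π.f 0 ≫ ((ChainComplex.single₀ (ModuleCat.{u} R)).map f).f 0 := by
    rw [hφ]; simp
  exact (ProjectiveResolution.mk₀_comp_extMk g (n+1) rfl
    ((mem_cocyc P Y n _).1 hg) ⟨φ, by simpa using hφ'⟩).symm

lemma zΘ_eq (z) : zΘ P Y n z = newMk P Y n ⟨zι P Y n z, zι_mem P Y n z⟩ := rfl

lemma zΘ_nat (hφ : φ.f 0 ≫ P.π.f 0 = P'.π.f 0 ≫ f) (z) :
    zΘ P' Y n ((HomologicalComplex.opcyclesMap (psi Y P' P φ) n).unop.hom z) =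
      (Abelian.Ext.mk₀ f).comp (zΘ P Y n z) (zero_add n) := by
  rw [zΘ_eq, zΘ_eq]
  exact newMk_nat f Y n P' P φ hφ _ _ _ _ (zι_nat Y n P' P φ z)
end nat

lemma extCmp_nat {X X' : ModuleCat.{u} R} (f : X' ⟶ X) (Y : ModuleCat.{u} R) (n : ℕ)
    (x : ((Ext R (ModuleCat.{u} R) n).obj (Opposite.op X)).obj Y) :
    extCmp X' Y n ((((Ext R (ModuleCat.{u} R) n).map f.op).app Y).hom x) =
      (Abelian.Ext.mk₀ f).comp (extCmp X Y n x) (zero_add n) := by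
  obtain ⟨z, rfl⟩ := zq_surj (projectiveResolution X) Y n x
  have hφ := ProjectiveResolution.lift_commutes_zero f (projectiveResolution X') (projectiveResolution X)
  rw [zq_nat f Y n _ _ _ hφ, extCmp_zq, extCmp_zq, zΘ_nat f Y n _ _ _ hφ]

end ExtCompare

section DFdef
open CategoryTheory.Abelian

/-- A linear cohomological delta functor, with Yoneda action of `Ext`. -/
structure DF (R : Type u) [CommRing R] where
  H : ℕ → ModuleCat.{u} R → Type u
  [acg : ∀ i N, AddCommGroup (H i N)]
  [mod : ∀ i N, Module R (H i N)]
  post : ∀ {A B : ModuleCat.{u} R} {k : ℕ} (_ : Abelian.Ext A B k) {i j : ℕ} (_ : i + k = j),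
    H i A →ₗ[R] H j B
  post_post : ∀ {A B C : ModuleCat.{u} R} {k l m : ℕ} (e : Abelian.Ext A B k) (e' : Abelian.Ext B C l)
    (hm : k + l = m) {i j p : ℕ} (h : i + k = j) (h' : j + l = p) (h'' : i + m = p) (x : H i A),
    post e' h' (post e h x) = post (e.comp e' hm) h'' x
  post_add : ∀ {A B : ModuleCat.{u} R} {k : ℕ} (e e' : Abelian.Ext A B k) {i j : ℕ} (h : i + k = j)
    (x : H i A), post (e + e') h x = post e h x + post e' h x
  post_smul : ∀ {A B : ModuleCat.{u} R} {k : ℕ} (r : R) (e : Abelian.Ext A B k) {i j : ℕ} (h : i + k = j)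
    (x : H i A), post (r • e) h x = r • post e h x
  post_id : ∀ {A : ModuleCat.{u} R} {i : ℕ} (x : H i A), post (Abelian.Ext.mk₀ (𝟙 A)) (add_zero i) x = x
  exact₁ : ∀ {S : ShortComplex (ModuleCat.{u} R)} (hS : S.ShortExact) {n₀ n₁ : ℕ} (h : n₀ + 1 = n₁)
    (x : H n₁ S.X₁), post (Abelian.Ext.mk₀ S.f) (add_zero n₁) x = 0 → ∃ y : H n₀ S.X₃, post hS.extClass h y = x
  exact₂ : ∀ {S : ShortComplex (ModuleCat.{u} R)} (_ : S.ShortExact) {n : ℕ}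
    (x : H n S.X₂), post (Abelian.Ext.mk₀ S.g) (add_zero n) x = 0 →
      ∃ y : H n S.X₁, post (Abelian.Ext.mk₀ S.f) (add_zero n) y = x
  exact₃ : ∀ {S : ShortComplex (ModuleCat.{u} R)} (hS : S.ShortExact) {n₀ n₁ : ℕ} (h : n₀ + 1 = n₁)
    (x : H n₀ S.X₃), post hS.extClass h x = 0 → ∃ y : H n₀ S.X₂, post (Abelian.Ext.mk₀ S.g) (add_zero n₀) y = x
  inj₀ : ∀ {S : ShortComplex (ModuleCat.{u} R)} (_ : S.ShortExact)
    (x : H 0 S.X₁), post (Abelian.Ext.mk₀ S.f) (add_zero 0) x = 0 → x = 0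

attribute [instance] DF.acg DF.mod

variable {R : Type u} [CommRing R]

noncomputable def extPost (X : ModuleCat.{u} R) {A B : ModuleCat.{u} R} {k : ℕ} (e : Abelian.Ext A B k)
    {i j : ℕ} (h : i + k = j) : Abelian.Ext X A i →ₗ[R] Abelian.Ext X B j where
  toFun x := x.comp e h
  map_add' x y := by simp
  map_smul' r x := by simp

noncomputable def extPre {X X' : ModuleCat.{u} R} (f : X' ⟶ X) (A : ModuleCat.{u} R) (i : ℕ) :
    Abelian.Ext X A i →ₗ[R] Abelian.Ext X' A i where
  toFun x := (Abelian.Ext.mk₀ f).comp x (zero_add i)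
  map_add' x y := by simp
  map_smul' r x := by simp

lemma extPost_extPre {X X' : ModuleCat.{u} R} (f : X' ⟶ X) {A B : ModuleCat.{u} R} {k : ℕ}
    (e : Abelian.Ext A B k) {i j : ℕ} (h : i + k = j) (x : Abelian.Ext X A i) :
    extPost X' e h (extPre f A i x) = extPre f B j (extPost X e h x) := by
  simp only [extPost, extPre, LinearMap.coe_mk, AddHom.coe_mk]
  exact Abelian.Ext.comp_assoc _ _ _ _ h (by lia)

lemma extPost_extPost (X : ModuleCat.{u} R) {A B C : ModuleCat.{u} R} {k l m : ℕ} (e : Abelian.Ext A B k)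
    (e' : Abelian.Ext B C l)
    (hm : k + l = m) {i j p : ℕ} (h : i + k = j) (h' : j + l = p) (h'' : i + m = p)
    (x : Abelian.Ext X A i) :
    extPost X e' h' (extPost X e h x) = extPost X (e.comp e' hm) h'' x := by
  simp only [extPost, LinearMap.coe_mk, AddHom.coe_mk]
  exact Abelian.Ext.comp_assoc _ _ _ _ hm (by lia)

/-- `Ext(X, -)` -/
noncomputable abbrev EDF (X : ModuleCat.{u} R) : DF R where
  H i N := Abelian.Ext X N i
  post e _ _ h := extPost X e h
  post_post e e' hm _ _ _ h h' h'' x := extPost_extPost X e e' hm h h' h'' x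
  post_add e e' _ _ h x := by simp [extPost]
  post_smul r e _ _ h x := by simp [extPost]
  post_id x := by simp [extPost]
  exact₁ hS n₀ n₁ h x hx := Abelian.Ext.covariant_sequence_exact₁ X hS x hx h
  exact₂ hS n x hx := Abelian.Ext.covariant_sequence_exact₂ X hS x hx
  exact₃ hS n₀ n₁ h x hx := Abelian.Ext.covariant_sequence_exact₃ X hS x h hx
  inj₀ {S} hS x hx := by
    have := hS.mono_f
    exact Abelian.Ext.postcomp_mk₀_injective_of_mono X S.f (hx.trans (Abelian.Ext.zero_comp _ _ _ _ (add_zero 0)).symm)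

section LC
variable (I : Ideal R)

abbrev Qn (n : ℕ) : ModuleCat.{u} R := ModuleCat.of R (R ⧸ I ^ n)

noncomputable def qmap {n m : ℕ} (h : n ≤ m) : Qn I m ⟶ Qn I n :=
  ModuleCat.ofHom (Submodule.mapQ (I ^ m) (I ^ n) LinearMap.id (Ideal.pow_le_pow_right h))

lemma qmap_id (n : ℕ) : qmap I (le_refl n) = 𝟙 _ := by
  ext
  rfl

lemma qmap_comp {n m p : ℕ} (h : n ≤ m) (h' : m ≤ p) : qmap I h' ≫ qmap I h = qmap I (h.trans h') := by
  ext
  rfl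

noncomputable def lcTr (i : ℕ) (N : ModuleCat.{u} R) (n m : ℕ) (h : n ≤ m) :
    Abelian.Ext (Qn I n) N i →ₗ[R] Abelian.Ext (Qn I m) N i := extPre (qmap I h) N i

instance lcSys (i : ℕ) (N : ModuleCat.{u} R) :
    DirectedSystem (fun n => Abelian.Ext (Qn I n) N i) (fun n m h => lcTr I i N n m h) where
  map_self n x := by
    simp only [lcTr, extPre, qmap_id]
    simp
  map_map n m p h h' x := by
    simp only [lcTr, extPre, LinearMap.coe_mk, AddHom.coe_mk, ← qmap_comp I h h',
      Abelian.Ext.mk₀_comp_mk₀_assoc]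

/-- local cohomology -/
def LC (i : ℕ) (N : ModuleCat.{u} R) : Type u :=
  Module.DirectLimit (fun n => Abelian.Ext (Qn I n) N i) (lcTr I i N)

noncomputable instance (i : ℕ) (N : ModuleCat.{u} R) : AddCommGroup (LC I i N) :=
  inferInstanceAs (AddCommGroup (Module.DirectLimit _ (lcTr I i N)))
noncomputable instance (i : ℕ) (N : ModuleCat.{u} R) : Module R (LC I i N) :=
  inferInstanceAs (Module R (Module.DirectLimit _ (lcTr I i N)))

noncomputable def lcOf (i : ℕ) (N : ModuleCat.{u} R) (n : ℕ) : Abelian.Ext (Qn I n) N i →ₗ[R] LC I i N :=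
  Module.DirectLimit.of R ℕ (fun n => Abelian.Ext (Qn I n) N i) (lcTr I i N) n

variable {I}

lemma lcOf_tr {i : ℕ} {N : ModuleCat.{u} R} {n m : ℕ} (h : n ≤ m) (x : Abelian.Ext (Qn I n) N i) :
    lcOf I i N m (extPre (qmap I h) N i x) = lcOf I i N n x :=
  Module.DirectLimit.of_f (f := lcTr I i N) (hij := h)

lemma lc_exists {i : ℕ} {N : ModuleCat.{u} R} (z : LC I i N) : ∃ n x, lcOf I i N n x = z :=
  Module.DirectLimit.exists_of (f := lcTr I i N) z

lemma lc_zero {i : ℕ} {N : ModuleCat.{u} R} {n : ℕ} (x : Abelian.Ext (Qn I n) N i)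
    (hx : lcOf I i N n x = 0) : ∃ m, ∃ h : n ≤ m, extPre (qmap I h) N i x = 0 :=
  Module.DirectLimit.of.zero_exact (f := lcTr I i N) hx

variable (I)
noncomputable def lcPost {A B : ModuleCat.{u} R} {k : ℕ} (e : Abelian.Ext A B k) {i j : ℕ} (h : i + k = j) :
    LC I i A →ₗ[R] LC I j B :=
  Module.DirectLimit.lift R ℕ _ (lcTr I i A) (fun n => lcOf I j B n ∘ₗ extPost (Qn I n) e h) (by
    intro n m hnm x
    simp only [lcTr, LinearMap.coe_comp, Function.comp_apply]
    rw [extPost_extPre, lcOf_tr])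
variable {I}

lemma lcPost_of {A B : ModuleCat.{u} R} {k : ℕ} (e : Abelian.Ext A B k) {i j : ℕ} (h : i + k = j)
    (n : ℕ) (x : Abelian.Ext (Qn I n) A i) :
    lcPost I e h (lcOf I i A n x) = lcOf I j B n (extPost _ e h x) :=
  Module.DirectLimit.lift_of (f := lcTr I i A) ..

variable (I)
noncomputable abbrev LDF : DF R where
  H i N := LC I i N
  post e _ _ h := lcPost I e h
  post_post e e' hm _ _ _ h h' h'' x := by
    obtain ⟨n, x, rfl⟩ := lc_exists x
    rw [lcPost_of, lcPost_of, lcPost_of, extPost_extPost]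
  post_add e e' _ _ h x := by
    obtain ⟨n, x, rfl⟩ := lc_exists x
    rw [lcPost_of, lcPost_of, lcPost_of, ← map_add]
    congr 1
    exact (EDF _).post_add e e' h x
  post_smul r e _ _ h x := by
    obtain ⟨n, x, rfl⟩ := lc_exists x
    rw [lcPost_of, lcPost_of, ← map_smul]
    congr 1
    exact (EDF _).post_smul r e h x
  post_id x := by
    obtain ⟨n, x, rfl⟩ := lc_exists x
    rw [lcPost_of]
    congr 1
    exact (EDF _).post_id x
  exact₁ hS n₀ n₁ h x hx := by
    obtain ⟨n, x, rfl⟩ := lc_exists x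
    rw [lcPost_of] at hx
    obtain ⟨m, hm, hx⟩ := lc_zero _ hx
    rw [← extPost_extPre] at hx
    obtain ⟨y, hy⟩ := Abelian.Ext.covariant_sequence_exact₁ _ hS _ hx h
    refine ⟨lcOf I _ _ m y, ?_⟩
    rw [lcPost_of, ← lcOf_tr hm, ← hy]
    rfl
  exact₂ hS k x hx := by
    obtain ⟨n, x, rfl⟩ := lc_exists x
    rw [lcPost_of] at hx
    obtain ⟨m, hm, hx⟩ := lc_zero _ hx
    rw [← extPost_extPre] at hx
    obtain ⟨y, hy⟩ := Abelian.Ext.covariant_sequence_exact₂ _ hS _ hx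
    refine ⟨lcOf I _ _ m y, ?_⟩
    rw [lcPost_of, ← lcOf_tr hm, ← hy]
    rfl
  exact₃ hS n₀ n₁ h x hx := by
    obtain ⟨n, x, rfl⟩ := lc_exists x
    rw [lcPost_of] at hx
    obtain ⟨m, hm, hx⟩ := lc_zero _ hx
    rw [← extPost_extPre] at hx
    obtain ⟨y, hy⟩ := Abelian.Ext.covariant_sequence_exact₃ _ hS _ h hx
    refine ⟨lcOf I _ _ m y, ?_⟩
    rw [lcPost_of, ← lcOf_tr hm, ← hy]
    rfl
  inj₀ hS x hx := by
    obtain ⟨n, x, rfl⟩ := lc_exists x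
    rw [lcPost_of] at hx
    obtain ⟨m, hm, hx⟩ := lc_zero _ hx
    rw [← extPost_extPre] at hx
    rw [← lcOf_tr hm, (EDF _).inj₀ hS _ hx, map_zero]

end LC

end DFdef

section bridge
open CategoryTheory.Limits
variable {R : Type u} [CommRing R] (I : Ideal R) (i : ℕ) (N : ModuleCat.{u} R)

noncomputable abbrev lcD : ℕᵒᵖᵒᵖ ⥤ ModuleCat.{u} R ⥤ ModuleCat.{u} R :=
  localCohomology.diagram (localCohomology.idealPowersDiagram I) i

instance : HasColimit (lcD I i) := inferInstance

noncomputable def brC : Cocone (lcD I i ⋙ (evaluation _ _).obj N) :=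
  ((evaluation _ _).obj N).mapCocone (colimit.cocone (lcD I i))

noncomputable def brCc : IsColimit (brC I i N) :=
  isColimitOfPreserves ((evaluation _ _).obj N) (colimit.isColimit (lcD I i))

example : (brC I i N).pt = ((localCohomology I i).obj N) := rfl

noncomputable def brι (n : ℕ) : Abelian.Ext (Qn I n) N i →ₗ[R] (brC I i N).pt :=
  ((brC I i N).ι.app (Opposite.op (Opposite.op n))).hom ∘ₗ (extCmp (Qn I n) N i).symm.toLinearMap

lemma brD {n m : ℕ} (h : n ≤ m) (x) :
   ((lcD I i ⋙ (evaluation _ _).obj N).map (homOfLE h).op.op).hom x =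
     (extCmp (Qn I m) N i).symm (extPre (qmap I h) N i (extCmp (Qn I n) N i x)) := by
  refine (LinearEquiv.eq_symm_apply (extCmp (Qn I m) N i)).2 ?_
  exact extCmp_nat (qmap I h) N i x

lemma brι_tr {n m : ℕ} (h : n ≤ m) (x : Abelian.Ext (Qn I n) N i) :
    brι I i N m (extPre (qmap I h) N i x) = brι I i N n x := by
  have h1 := brD I i N h ((extCmp (Qn I n) N i).symm x)
  rw [LinearEquiv.apply_symm_apply] at h1
  have h2 := (brC I i N).w (homOfLE h).op.op
  have h3 := congrArg (fun t => t.hom ((extCmp (Qn I n) N i).symm x)) h2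
  refine Eq.trans ?_ h3
  exact congrArg ((brC I i N).ι.app (Opposite.op (Opposite.op m))).hom h1.symm

noncomputable def brMap : LC I i N →ₗ[R] (brC I i N).pt :=
  Module.DirectLimit.lift R ℕ _ (lcTr I i N) (brι I i N) (fun _ _ h x => brι_tr I i N h x)

lemma brMap_of (n x) : brMap I i N (lcOf I i N n x) = brι I i N n x :=
  Module.DirectLimit.lift_of (f := lcTr I i N) ..

instance brPres : PreservesColimit (lcD I i ⋙ (evaluation (ModuleCat.{u} R) (ModuleCat.{u} R)).obj N)
    (forget (ModuleCat.{u} R)) := by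
  have h : PreservesFilteredColimitsOfSize.{0, 0} (forget (ModuleCat.{u} R)) :=
    preservesSmallestFilteredColimits_of_preservesFilteredColimits.{u, u} _
  have := h.preserves_filtered_colimits ℕᵒᵖᵒᵖ
  infer_instance

lemma brMap_bij : Function.Bijective (brMap I i N) := by
  constructor
  · rw [injective_iff_map_eq_zero]
    intro x hx
    obtain ⟨n, x, rfl⟩ := lc_exists x
    rw [brMap_of] at hx
    have h0 : ((brC I i N).ι.app (Opposite.op (Opposite.op n))).hom ((extCmp (Qn I n) N i).symm x) =
      ((brC I i N).ι.app (Opposite.op (Opposite.op n))).hom 0 := hx.trans (map_zero _).symm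
    obtain ⟨k, f, g, h⟩ := Concrete.isColimit_exists_of_rep_eq _ (brCc I i N) _ _ h0
    have hm : n ≤ k.unop.unop := leOfHom f.unop.unop
    have hf : f = (homOfLE hm).op.op := Subsingleton.elim _ _
    have h1 : ((lcD I i ⋙ (evaluation _ _).obj N).map f).hom ((extCmp (Qn I n) N i).symm x) = 0 :=
      h.trans (map_zero ((lcD I i ⋙ (evaluation _ _).obj N).map g).hom)
    subst hf
    have h2 := (brD I i N hm ((extCmp (Qn I n) N i).symm x)).symm.trans h1
    rw [LinearEquiv.apply_symm_apply] at h2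
    have h3 := (LinearEquiv.map_eq_zero_iff (extCmp (Qn I k.unop.unop) N i).symm).1 h2
    rw [← lcOf_tr hm, h3, map_zero]
  · intro y
    obtain ⟨k, x, hx⟩ := Concrete.isColimit_exists_rep _ (brCc I i N) y
    refine ⟨lcOf I i N k.unop.unop (extCmp (Qn I _) N i x), ?_⟩
    rw [brMap_of]
    refine Eq.trans ?_ hx
    exact congrArg ((brC I i N).ι.app k).hom (LinearEquiv.symm_apply_apply _ x)

noncomputable def lcEquiv : LC I i N ≃ₗ[R] (localCohomology I i).obj N :=
  LinearEquiv.ofBijective (brMap I i N) (brMap_bij I i N)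
end bridge

section DFgen
variable {R : Type u} [CommRing R]

/-- short exact sequences of modules -/
structure SES {A B C : Type u} [AddCommGroup A] [Module R A] [AddCommGroup B] [Module R B]
    [AddCommGroup C] [Module R C] (f : A →ₗ[R] B) (g : B →ₗ[R] C) : Prop where
  inj : Function.Injective f
  exact : Function.Exact f g
  surj : Function.Surjective g

variable {A B C : Type u} [AddCommGroup A] [Module R A] [AddCommGroup B] [Module R B]
    [AddCommGroup C] [Module R C]

namespace SES
variable {f : A →ₗ[R] B} {g : B →ₗ[R] C}

abbrev sc (h : SES f g) : ShortComplex (ModuleCat.{u} R) :=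
  ShortComplex.mk (ModuleCat.ofHom f) (ModuleCat.ofHom g) (by
    ext x
    exact h.exact.apply_apply_eq_zero x)

lemma se (h : SES f g) : h.sc.ShortExact where
  exact := by
    rw [ShortComplex.ShortExact.moduleCat_exact_iff_function_exact]
    exact h.exact
  mono_f := (ModuleCat.mono_iff_injective _).2 h.inj
  epi_g := (ModuleCat.epi_iff_surjective _).2 h.surj

lemma ofSub (p : Submodule R A) : SES p.subtype p.mkQ :=
  ⟨p.injective_subtype, by rw [LinearMap.exact_iff]; simp, p.mkQ_surjective⟩

lemma ofInj (f : A →ₗ[R] B) (hf : Function.Injective f) : SES f (LinearMap.range f).mkQ :=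
  ⟨hf, by rw [LinearMap.exact_iff]; simp, Submodule.mkQ_surjective _⟩

lemma ofSurj (f : A →ₗ[R] B) (hf : Function.Surjective f) : SES (LinearMap.ker f).subtype f :=
  ⟨Submodule.injective_subtype _, by rw [LinearMap.exact_iff]; simp, hf⟩
end SES

namespace DF
variable (D : DF R)

abbrev h (i : ℕ) (A : Type u) [AddCommGroup A] [Module R A] : Type u := D.H i (ModuleCat.of R A)

noncomputable def mp (i : ℕ) (f : A →ₗ[R] B) : D.h i A →ₗ[R] D.h i B :=
  D.post (Abelian.Ext.mk₀ (ModuleCat.ofHom f)) (add_zero i)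

lemma mp_comp (i : ℕ) (f : A →ₗ[R] B) (g : B →ₗ[R] C) (x) :
    D.mp i g (D.mp i f x) = D.mp i (g ∘ₗ f) x := by
  unfold mp
  rw [D.post_post _ _ (add_zero 0) _ _ (add_zero i), Abelian.Ext.mk₀_comp_mk₀]
  rfl

lemma mp_id (i : ℕ) (x : D.h i A) : D.mp i LinearMap.id x = x := D.post_id x

lemma mp_add (i : ℕ) (f g : A →ₗ[R] B) (x) : D.mp i (f + g) x = D.mp i f x + D.mp i g x := by
  unfold mp
  rw [ModuleCat.ofHom_add, Abelian.Ext.mk₀_add, D.post_add]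

lemma mp_smul (i : ℕ) (r : R) (f : A →ₗ[R] B) (x) : D.mp i (r • f) x = r • D.mp i f x := by
  unfold mp
  have : ModuleCat.ofHom (r • f) = r • ModuleCat.ofHom f := rfl
  rw [this, Abelian.Ext.mk₀_smul, D.post_smul]

lemma mp_zero (i : ℕ) (x) : D.mp i (0 : A →ₗ[R] B) x = 0 := by
  have := D.mp_smul i (0 : R) (0 : A →ₗ[R] B) x
  simpa using this

lemma mp_sum (i : ℕ) {ι : Type*} (s : Finset ι) (f : ι → A →ₗ[R] B) (x) :
    D.mp i (∑ j ∈ s, f j) x = ∑ j ∈ s, D.mp i (f j) x := by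
  classical
  induction s using Finset.induction_on with
  | empty => simp [mp_zero]
  | insert a s ha ih => rw [Finset.sum_insert ha, Finset.sum_insert ha, mp_add, ih]

noncomputable def mpe (i : ℕ) (e : A ≃ₗ[R] B) : D.h i A ≃ₗ[R] D.h i B :=
  LinearEquiv.ofLinear (D.mp i e.toLinearMap) (D.mp i e.symm.toLinearMap)
    (by ext x; simp [mp_comp, mp_id]) (by ext x; simp [mp_comp, mp_id])

variable {f : A →ₗ[R] B} {g : B →ₗ[R] C}
noncomputable def dl (i : ℕ) (S : SES f g) : D.h i C →ₗ[R] D.h (i+1) A :=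
  D.post S.se.extClass rfl

lemma ex₂ (i : ℕ) (S : SES f g) : LinearMap.range (D.mp i f) = LinearMap.ker (D.mp i g) := by
  ext x
  constructor
  · rintro ⟨y, rfl⟩
    rw [LinearMap.mem_ker, mp_comp, S.exact.linearMap_comp_eq_zero, mp_zero]
  · intro hx
    exact D.exact₂ S.se x hx

lemma ex₃ (i : ℕ) (S : SES f g) : LinearMap.range (D.mp i g) = LinearMap.ker (D.dl i S) := by
  ext x
  constructor
  · rintro ⟨y, rfl⟩
    rw [LinearMap.mem_ker]
    have := D.post_post (Abelian.Ext.mk₀ (ModuleCat.ofHom g)) S.se.extClass (zero_add 1) (add_zero i) rfl rfl y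
    refine this.trans ?_
    rw [S.se.comp_extClass]
    have := D.post_smul (0:R) (0 : Abelian.Ext (ModuleCat.of R B) (ModuleCat.of R A) 1) (i := i) rfl y
    simpa using this
  · intro hx
    exact D.exact₃ S.se rfl x hx

lemma ex₁ (i : ℕ) (S : SES f g) : LinearMap.range (D.dl i S) = LinearMap.ker (D.mp (i+1) f) := by
  ext x
  constructor
  · rintro ⟨y, rfl⟩
    rw [LinearMap.mem_ker]
    have := D.post_post S.se.extClass (Abelian.Ext.mk₀ (ModuleCat.ofHom f)) (add_zero 1) (i := i) rfl (add_zero _) rfl y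
    refine this.trans ?_
    rw [S.se.extClass_comp]
    have := D.post_smul (0:R) (0 : Abelian.Ext (ModuleCat.of R C) (ModuleCat.of R B) 1) (i := i) rfl y
    simpa using this
  · intro hx
    exact D.exact₁ S.se rfl x hx

lemma ex₀ (S : SES f g) : Function.Injective (D.mp 0 f) := by
  rw [injective_iff_map_eq_zero]
  exact fun x hx => D.inj₀ S.se x hx

lemma sub_of_rk {X Y Z : Type*} [AddCommGroup X] [Module R X] [AddCommGroup Y] [Module R Y]
    [AddCommGroup Z] [Module R Z] [Subsingleton X] [Subsingleton Z] (a : X →ₗ[R] Y) (b : Y →ₗ[R] Z)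
    (h : LinearMap.range a = LinearMap.ker b) : Subsingleton Y := by
  refine ⟨fun x y => ?_⟩
  have : ∀ x : Y, x = 0 := by
    intro x
    have hx : x ∈ LinearMap.ker b := Subsingleton.elim _ _
    rw [← h] at hx
    obtain ⟨y, rfl⟩ := hx
    rw [Subsingleton.elim y 0, map_zero]
  rw [this x, this y]

lemma inj_of_rk {X Y Z : Type*} [AddCommGroup X] [Module R X] [AddCommGroup Y] [Module R Y]
    [AddCommGroup Z] [Module R Z] [Subsingleton X] {a : X →ₗ[R] Y} {b : Y →ₗ[R] Z}
    (h : LinearMap.range a = LinearMap.ker b) : Function.Injective b := by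
  rw [← LinearMap.ker_eq_bot, ← h, LinearMap.range_eq_bot]
  ext x
  rw [Subsingleton.elim x 0, map_zero, map_zero]

lemma surj_of_rk {X Y Z : Type*} [AddCommGroup X] [Module R X] [AddCommGroup Y] [Module R Y]
    [AddCommGroup Z] [Module R Z] [Subsingleton Z] {a : X →ₗ[R] Y} {b : Y →ₗ[R] Z}
    (h : LinearMap.range a = LinearMap.ker b) : Function.Surjective a := by
  rw [← LinearMap.range_eq_top, h, LinearMap.ker_eq_top]
  ext x
  exact Subsingleton.elim _ _

/-- connecting iso -/
noncomputable def dle (i : ℕ) (S : SES f g) (h1 : Subsingleton (D.h i B)) (h2 : Subsingleton (D.h (i+1) B)) :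
    D.h i C ≃ₗ[R] D.h (i+1) A :=
  LinearEquiv.ofBijective (D.dl i S) ⟨inj_of_rk (D.ex₃ i S), surj_of_rk (D.ex₁ i S)⟩

lemma g_inj (i : ℕ) (S : SES f g) (h1 : Subsingleton (D.h i A)) : Function.Injective (D.mp i g) :=
  inj_of_rk (D.ex₂ i S)

lemma g_surj (i : ℕ) (S : SES f g) (h1 : Subsingleton (D.h (i+1) A)) : Function.Surjective (D.mp i g) :=
  surj_of_rk (D.ex₃ i S)

lemma f_surj (i : ℕ) (S : SES f g) (h1 : Subsingleton (D.h i C)) : Function.Surjective (D.mp i f) :=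
  surj_of_rk (D.ex₂ i S)

lemma f_inj (i : ℕ) (S : SES f g) (h1 : Subsingleton (D.h i C)) : Function.Injective (D.mp (i+1) f) :=
  inj_of_rk (D.ex₁ i S)

/-- every element is killed by a power of `a` -/
def Tor (a : R) : Prop := ∀ (i : ℕ) (N : ModuleCat.{u} R) (x : D.H i N), ∃ n : ℕ, a ^ n • x = 0

lemma zero_of_inv {a : R} (ha : D.Tor a) (i : ℕ) (g : A →ₗ[R] A) (hg : a • g = LinearMap.id) :
    Subsingleton (D.h i A) := by
  have key : ∀ x : D.h i A, a • x = 0 → x = 0 := by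
    intro x hx
    rw [← D.mp_id i x, ← hg, mp_smul, ← map_smul, hx, map_zero]
  have key2 : ∀ (n : ℕ) (x : D.h i A), a ^ n • x = 0 → x = 0 := by
    intro n
    induction n with
    | zero => intro x hx; simpa using hx
    | succ n ih =>
      intro x hx
      rw [pow_succ, mul_smul] at hx
      exact key x (ih _ hx)
  have : ∀ x : D.h i A, x = 0 := fun x => (ha i _ x).elim fun n hn => key2 n x hn
  exact ⟨fun x y => by rw [this x, this y]⟩

lemma zero_pi {ι : Type u} [Fintype ι] (i : ℕ) (M : ι → Type u) [∀ j, AddCommGroup (M j)]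
    [∀ j, Module R (M j)] (h : ∀ j, Subsingleton (D.h i (M j))) : Subsingleton (D.h i (∀ j, M j)) := by
  classical
  have : ∀ x : D.h i (∀ j, M j), x = 0 := by
    intro x
    have hid : (LinearMap.id : (∀ j, M j) →ₗ[R] ∀ j, M j) =
      ∑ j, LinearMap.single R M j ∘ₗ LinearMap.proj j := by
      ext j m k
      simp [Pi.single_apply]
    rw [← D.mp_id i x, hid, mp_sum]
    refine Finset.sum_eq_zero fun j _ => ?_
    rw [← mp_comp, Subsingleton.elim (D.mp i (LinearMap.proj j) x) 0, map_zero]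
  exact ⟨fun x y => by rw [this x, this y]⟩

lemma zero_loc {a : R} (ha : D.Tor a) (i : ℕ) :
    Subsingleton (D.h i (LocalizedModule (Submonoid.powers a) A)) := by
  have hu := IsLocalizedModule.map_units (LocalizedModule.mkLinearMap (Submonoid.powers a) A)
    ⟨a, Submonoid.mem_powers a⟩
  obtain ⟨u, hu⟩ := hu
  refine D.zero_of_inv ha i (↑u⁻¹) ?_
  have h2 : (u : Module.End R (LocalizedModule (Submonoid.powers a) A)) * ↑u⁻¹ = 1 := u.mul_inv
  rw [hu] at h2
  exact h2

end DF
end DFgen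

section EE
variable {R : Type u} [CommRing R]

lemma ext_smul_zero {X N : ModuleCat.{u} R} {i : ℕ} {a : R} (h : ∀ x : X, a • x = 0)
    (e : Abelian.Ext X N i) : a • e = 0 := by
  have h1 : a • 𝟙 X = 0 := by
    ext x
    exact h x
  rw [← Abelian.Ext.mk₀_id_comp e, ← Abelian.Ext.smul_comp, ← Abelian.Ext.mk₀_smul, h1]
  simp

lemma quot_smul_zero (J : Ideal R) {a : R} (ha : a ∈ J) (x : R ⧸ J) : a • x = 0 := by
  obtain ⟨y, rfl⟩ := Ideal.Quotient.mk_surjective x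
  rw [← Ideal.Quotient.mkₐ_eq_mk R, ← map_smul, Ideal.Quotient.mkₐ_eq_mk, Ideal.Quotient.eq_zero_iff_mem]
  exact J.mul_mem_right _ ha

lemma lc_smul_zero {I : Ideal R} {i : ℕ} {N : ModuleCat.{u} R} (z : LC I i N) :
    ∃ n : ℕ, ∀ r ∈ I ^ n, r • z = 0 := by
  obtain ⟨n, x, rfl⟩ := lc_exists z
  refine ⟨n, fun r hr => ?_⟩
  rw [← map_smul, ext_smul_zero (fun x => quot_smul_zero _ hr x), map_zero]

noncomputable abbrev EI (I : Ideal R) : DF R := EDF (ModuleCat.of R (R ⧸ I))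

lemma EI_smul {I : Ideal R} {a : R} (ha : a ∈ I) {i : ℕ} {N : ModuleCat.{u} R} (x : (EI I).H i N) :
    a • x = 0 := ext_smul_zero (fun x => quot_smul_zero _ ha x) x

lemma EI_tor {I : Ideal R} {a : R} (ha : a ∈ I) : (EI I).Tor a := by
  intro i N x
  refine ⟨1, ?_⟩
  rw [pow_one]
  exact EI_smul ha x

lemma LDF_tor {I : Ideal R} {a : R} (ha : a ∈ I) : (LDF I).Tor a := by
  intro i N x
  obtain ⟨n, hn⟩ := lc_smul_zero x
  exact ⟨n, hn _ (Ideal.pow_mem_pow ha n)⟩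

lemma lc_support {I : Ideal R} {i : ℕ} {N : ModuleCat.{u} R} :
    Module.support R (LC I i N) ⊆ PrimeSpectrum.zeroLocus (I : Set R) := by
  intro p hp a ha
  by_contra hap
  rw [Module.mem_support_iff_exists_annihilator] at hp
  obtain ⟨m, hm⟩ := hp
  obtain ⟨n, hn⟩ := LDF_tor ha i N m
  have : a ^ n ∈ (Submodule.span R {m}).annihilator := by
    rw [Submodule.mem_annihilator_span_singleton]
    exact hn
  exact hap (p.2.mem_of_pow_mem n (hm this))

/-- I-torsion submodule -/
def Gam (I : Ideal R) (N : Type u) [AddCommGroup N] [Module R N] : Submodule R N where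
  carrier := {x | ∃ n : ℕ, ∀ r ∈ I ^ n, r • x = 0}
  zero_mem' := ⟨0, by simp⟩
  add_mem' := by
    rintro x y ⟨n, hn⟩ ⟨m, hm⟩
    refine ⟨n + m, fun r hr => ?_⟩
    rw [smul_add, hn r (Ideal.pow_le_pow_right (by lia) hr), hm r (Ideal.pow_le_pow_right (by lia) hr),
      add_zero]
  smul_mem' := by
    rintro c x ⟨n, hn⟩
    refine ⟨n, fun r hr => ?_⟩
    rw [smul_comm, hn r hr, smul_zero]

lemma mem_Gam {I : Ideal R} {N : Type u} [AddCommGroup N] [Module R N] {x : N} :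
    x ∈ Gam I N ↔ ∃ n : ℕ, ∀ r ∈ I ^ n, r • x = 0 := Iff.rfl

/-- N is I-torsion -/
def ITor (I : Ideal R) (N : Type u) [AddCommGroup N] [Module R N] : Prop :=
  ∀ x : N, ∃ n : ℕ, ∀ r ∈ I ^ n, r • x = 0

lemma Gam_ITor (I : Ideal R) (N : Type u) [AddCommGroup N] [Module R N] : ITor I (Gam I N) := by
  rintro ⟨x, n, hn⟩
  exact ⟨n, fun r hr => Subtype.ext (hn r hr)⟩

lemma Gam_quot [IsNoetherianRing R] (I : Ideal R) (N : Type u) [AddCommGroup N] [Module R N] :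
    Gam I (N ⧸ Gam I N) = ⊥ := by
  rw [eq_bot_iff]
  intro x hx
  obtain ⟨x, rfl⟩ := Submodule.Quotient.mk_surjective _ x
  obtain ⟨n, hn⟩ := hx
  rw [Submodule.mem_bot, Submodule.Quotient.mk_eq_zero]
  obtain ⟨s, hs⟩ := (isNoetherianRing_iff_ideal_fg R).1 inferInstance (I ^ n)
  have h1 : ∀ r ∈ s, ∃ m : ℕ, ∀ t ∈ I ^ m, t • (r • x) = 0 := by
    intro r hr
    have h2 := hn r (hs ▸ Ideal.subset_span hr)
    rw [← Submodule.Quotient.mk_smul, Submodule.Quotient.mk_eq_zero] at h2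
    exact h2
  choose! m hm using h1
  refine ⟨s.sup m + n, ?_⟩
  rw [pow_add]
  intro r hr
  refine Submodule.mul_induction_on hr ?_ ?_
  · intro a ha b hb
    rw [← hs] at hb
    rw [mul_smul]
    refine Submodule.span_induction (p := fun b _ => a • b • x = 0) ?_ ?_ ?_ ?_ hb
    · intro c hc
      exact hm c hc a (Ideal.pow_le_pow_right (Finset.le_sup hc) ha)
    · simp
    · intro b c _ _ h1 h2
      rw [add_smul, smul_add, h1, h2, add_zero]
    · intro c b _ h1
      rw [smul_eq_mul, mul_smul, smul_comm, h1, smul_zero]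
  · intro a b ha hb
    rw [add_smul, ha, hb, add_zero]

section ev
variable (I : Ideal R) (N : Type u) [AddCommGroup N] [Module R N]

noncomputable def ev0 (X : ModuleCat.{u} R) (x : X) :
    Abelian.Ext X (ModuleCat.of R N) 0 →ₗ[R] N where
  toFun e := (Abelian.Ext.linearEquiv₀ (R := R) e).hom x
  map_add' a b := by simp
  map_smul' a b := by simp

lemma ev0_mk (X : ModuleCat.{u} R) (x : X) (f : X ⟶ ModuleCat.of R N) :
    ev0 N X x (Abelian.Ext.mk₀ f) = f.hom x := by
  have : Abelian.Ext.linearEquiv₀ (R := R) (Abelian.Ext.mk₀ f) = f := by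
    rw [← Abelian.Ext.linearEquiv₀_symm_apply (R := R), LinearEquiv.apply_symm_apply]
  simp [ev0, this]

noncomputable def lcEv : LC I 0 (ModuleCat.of R N) →ₗ[R] N :=
  Module.DirectLimit.lift R ℕ _ (lcTr I 0 (ModuleCat.of R N)) (fun n => ev0 N (Qn I n) (1 : R ⧸ I ^ n)) (by
    intro n m h x
    obtain ⟨f, rfl⟩ := Abelian.Ext.mk₀_bijective _ _ |>.2 x
    simp only [lcTr, extPre, LinearMap.coe_mk, AddHom.coe_mk]
    rw [Abelian.Ext.mk₀_comp_mk₀, ev0_mk, ev0_mk]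
    rfl)

lemma lcEv_of (n x) : lcEv I N (lcOf I 0 _ n x) = ev0 N (Qn I n) (1 : R ⧸ I ^ n) x :=
  Module.DirectLimit.lift_of (f := lcTr I 0 (ModuleCat.of R N)) ..

lemma quot_hom_ext {J : Ideal R} (f : ModuleCat.of R (R ⧸ J) ⟶ ModuleCat.of R N)
    (h : f.hom (1 : R ⧸ J) = 0) : f = 0 := by
  ext x
  change f.hom (1 : R ⧸ J) = 0
  exact h

lemma lcEv_inj : Function.Injective (lcEv I N) := by
  rw [injective_iff_map_eq_zero]
  intro z hz
  obtain ⟨n, x, rfl⟩ := lc_exists z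
  rw [lcEv_of] at hz
  obtain ⟨f, rfl⟩ := Abelian.Ext.mk₀_bijective _ _ |>.2 x
  rw [ev0_mk] at hz
  rw [quot_hom_ext N f hz]
  simp

lemma lcEv_range : LinearMap.range (lcEv I N) = Gam I N := by
  ext y
  constructor
  · rintro ⟨z, rfl⟩
    obtain ⟨n, hn⟩ := lc_smul_zero z
    exact ⟨n, fun r hr => by rw [← map_smul, hn r hr, map_zero]⟩
  · rintro ⟨n, hn⟩
    let f : (R ⧸ I ^ n) →ₗ[R] N := (I ^ n).liftQ (LinearMap.toSpanSingleton R N y) (by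
      intro r hr
      simpa using hn r hr)
    refine ⟨lcOf I 0 _ n (Abelian.Ext.mk₀ (ModuleCat.ofHom f)), ?_⟩
    rw [lcEv_of, ev0_mk]
    change (LinearMap.toSpanSingleton R N y) 1 = y
    simp

noncomputable def lcGam : LC I 0 (ModuleCat.of R N) ≃ₗ[R] Gam I N :=
  (LinearEquiv.ofInjective _ (lcEv_inj I N)).trans (LinearEquiv.ofEq _ _ (lcEv_range I N))

lemma EI_zero (h : Gam I N = ⊥) : Subsingleton ((EI I).h 0 N) := by
  have : ∀ x : (EI I).h 0 N, x = 0 := by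
    intro x
    obtain ⟨f, rfl⟩ := Abelian.Ext.mk₀_bijective _ _ |>.2 x
    have h1 : f.hom (1 : R ⧸ I) ∈ Gam I N := by
      refine ⟨1, fun r hr => ?_⟩
      rw [pow_one] at hr
      have := f.hom.map_smul r (1 : R ⧸ I)
      rw [quot_smul_zero I hr] at this
      rw [← this, map_zero]
    rw [h] at h1
    rw [quot_hom_ext N f h1]
    simp
  exact ⟨fun x y => by rw [this x, this y]⟩

lemma LDF_zero (h : Gam I N = ⊥) : Subsingleton ((LDF I).h 0 N) := by
  have h1 := (lcGam I N).toEquiv.subsingleton_congr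
  rw [h1, h]
  infer_instance
end ev
end EE

section FF
variable {R : Type u} [CommRing R]
variable {A B C : Type u} [AddCommGroup A] [Module R A] [AddCommGroup B] [Module R B]
    [AddCommGroup C] [Module R C] {f : A →ₗ[R] B} {g : B →ₗ[R] C}
variable {A' B' C' : Type u} [AddCommGroup A'] [Module R A'] [AddCommGroup B'] [Module R B']
    [AddCommGroup C'] [Module R C'] {f' : A' →ₗ[R] B'} {g' : B' →ₗ[R] C'}

lemma proj_shift [Module.Projective R B] (S : SES f g) {N : ModuleCat.{u} R} {k : ℕ}
    (e : Abelian.Ext (ModuleCat.of R C) N (k+1)) :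
    ∃ e' : Abelian.Ext (ModuleCat.of R A) N k, S.se.extClass.comp e' (add_comm 1 k) = e := by
  have : Projective S.sc.X₂ := (IsProjective.iff_projective B).1 inferInstance
  exact precomp_extClass_surjective_of_projective_X₂ N S.se k e

lemma ses_nat (S' : SES f' g') (S : SES f g) (a : A' →ₗ[R] A) (b : B' →ₗ[R] B) (c : C' →ₗ[R] C)
    (h1 : f ∘ₗ a = b ∘ₗ f') (h2 : g ∘ₗ b = c ∘ₗ g') :
    S'.se.extClass.comp (Abelian.Ext.mk₀ (ModuleCat.ofHom a)) (add_zero 1) =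
      (Abelian.Ext.mk₀ (ModuleCat.ofHom c)).comp S.se.extClass (zero_add 1) := by
  let φ : S'.sc ⟶ S.sc :=
    { τ₁ := ModuleCat.ofHom a
      τ₂ := ModuleCat.ofHom b
      τ₃ := ModuleCat.ofHom c
      comm₁₂ := ModuleCat.hom_ext h1
      comm₂₃ := ModuleCat.hom_ext h2 }
  exact ShortComplex.ShortExact.extClass_naturality S'.se S.se φ

lemma ses_nat_comp (S' : SES f' g') (S : SES f g) (a : A' →ₗ[R] A) (b : B' →ₗ[R] B) (c : C' →ₗ[R] C)
    (h1 : f ∘ₗ a = b ∘ₗ f') (h2 : g ∘ₗ b = c ∘ₗ g') {N : ModuleCat.{u} R} {k : ℕ}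
    (e : Abelian.Ext (ModuleCat.of R A) N k) :
    (Abelian.Ext.mk₀ (ModuleCat.ofHom c)).comp (S.se.extClass.comp e (add_comm 1 k)) (zero_add _) =
     S'.se.extClass.comp ((Abelian.Ext.mk₀ (ModuleCat.ofHom a)).comp e (zero_add k)) (add_comm 1 k) := by
  rw [← Abelian.Ext.comp_assoc _ _ _ (zero_add 1) _ (by lia), ← ses_nat S' S a b c h1 h2,
    ← Abelian.Ext.comp_assoc _ _ _ (add_zero 1) _ (by lia)]

variable [IsNoetherianRing R] (I : Ideal R)

/-- Artin–Rees key lemma. -/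
lemma key_torsion (N : Type u) [AddCommGroup N] [Module R N] (hN : ITor I N) (k : ℕ) :
    ∀ (L : Type u) [AddCommGroup L] [Module R L] [Module.Finite R L]
      (e : Abelian.Ext (ModuleCat.of R L) (ModuleCat.of R N) k),
      ∃ m : ℕ, ∀ (L' : Type u) [AddCommGroup L'] [Module R L'] (f : L' →ₗ[R] L),
        (∀ y, f y ∈ (I ^ m • ⊤ : Submodule R L)) →
        (Abelian.Ext.mk₀ (ModuleCat.ofHom f)).comp e (zero_add k) = 0 := by
  induction k with
  | zero =>
    intro L _ _ _ e
    obtain ⟨φ, rfl⟩ := Abelian.Ext.mk₀_bijective _ _ |>.2 e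
    obtain ⟨s, hs⟩ := (Module.Finite.fg_top : (⊤ : Submodule R L).FG)
    choose m hm using hN
    refine ⟨s.sup (fun x => m (φ.hom x)), fun L' _ _ f hf => ?_⟩
    have key : ∀ r ∈ I ^ (s.sup (fun x => m (φ.hom x))), ∀ x : L, r • φ.hom x = 0 := by
      intro r hr x
      have hx : x ∈ Submodule.span R (s : Set L) := hs ▸ Submodule.mem_top
      refine Submodule.span_induction (p := fun x _ => r • φ.hom x = 0) ?_ ?_ ?_ ?_ hx
      · intro c hc
        exact hm _ r (Ideal.pow_le_pow_right (Finset.le_sup (f := fun x => m (φ.hom x)) hc) hr)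
      · simp
      · intro b c _ _ h1 h2
        rw [map_add, smul_add, h1, h2, add_zero]
      · intro c b _ h1
        rw [map_smul, smul_comm, h1, smul_zero]
    rw [Abelian.Ext.mk₀_comp_mk₀, Abelian.Ext.mk₀_eq_zero_iff]
    ext y
    change φ.hom (f y) = 0
    refine Submodule.smul_induction_on (hf y) ?_ ?_
    · intro r hr x _
      rw [map_smul, key r hr x]
    · intro x y hx hy
      rw [map_add, hx, hy, add_zero]
  | succ k ih =>
    intro L _ _ _ e
    obtain ⟨F, _, _, _, _, π, hπ⟩ := Module.exists_finite_presentation R L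
    let S := SES.ofSurj π hπ
    obtain ⟨e', rfl⟩ := proj_shift S e
    obtain ⟨m, hm⟩ := ih _ e'
    obtain ⟨c, hc⟩ := Ideal.exists_pow_inf_eq_pow_smul I (LinearMap.ker π)
    refine ⟨m + c, fun L' _ _ f hf => ?_⟩
    let P : Submodule R (L' × (I ^ (m + c) • ⊤ : Submodule R F)) :=
      LinearMap.ker (LinearMap.coprod f (-(π ∘ₗ Submodule.subtype _)))
    have hP : ∀ y, y ∈ P ↔ f y.1 = π y.2.1 := by
      intro y
      simp [P, LinearMap.mem_ker, sub_eq_zero, ← sub_eq_add_neg]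
    let q : P →ₗ[R] L' := LinearMap.fst R _ _ ∘ₗ P.subtype
    have hq : Function.Surjective q := by
      intro y
      have h1 := hf y
      have h2 : (I ^ (m+c) • ⊤ : Submodule R L) = Submodule.map π (I ^ (m + c) • ⊤) := by
        rw [Submodule.map_smul'', Submodule.map_top, LinearMap.range_eq_top.2 hπ]
      rw [h2] at h1
      obtain ⟨x, hx, hxy⟩ := h1
      exact ⟨⟨(y, ⟨x, hx⟩), (hP _).2 hxy.symm⟩, rfl⟩
    let b : P →ₗ[R] F := Submodule.subtype _ ∘ₗ LinearMap.snd R _ _ ∘ₗ P.subtype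
    have hb : ∀ y : LinearMap.ker q, b y.1 ∈ LinearMap.ker π := by
      intro y
      rw [LinearMap.mem_ker]
      refine ((hP _).1 y.1.2).symm.trans ?_
      have : y.1.1.1 = 0 := y.2
      rw [this, map_zero]
    let a : LinearMap.ker q →ₗ[R] LinearMap.ker π :=
      (b ∘ₗ Submodule.subtype _).codRestrict _ hb
    have S' := SES.ofSurj q hq
    have h5 : ∀ y, a y ∈ (I ^ m • ⊤ : Submodule R (LinearMap.ker π)) := by
      intro y
      have h1 : b y.1 ∈ (I ^ (m + c) • ⊤ ⊓ LinearMap.ker π : Submodule R F) := ⟨y.1.1.2.2, hb y⟩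
      rw [hc _ (by lia), Nat.add_sub_cancel] at h1
      have h2 : b y.1 ∈ I ^ m • LinearMap.ker π := Submodule.smul_mono le_rfl inf_le_right h1
      have h3 : I ^ m • LinearMap.ker π = Submodule.map (LinearMap.ker π).subtype (I ^ m • ⊤) := by
        rw [Submodule.map_smul'', Submodule.map_top, Submodule.range_subtype]
      rw [h3] at h2
      obtain ⟨z, hz, hzy⟩ := h2
      have : z = a y := Subtype.ext hzy
      rwa [← this]
    have h6 := hm (LinearMap.ker q) a h5
    have h7 := ses_nat_comp S' S a b f rfl (by
      ext y
      exact ((hP _).1 y.2).symm) e'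
    rw [h7, h6, Abelian.Ext.comp_zero]

lemma lc_torsion_zero (N : Type u) [AddCommGroup N] [Module R N] (hN : ITor I N) (k : ℕ) :
    Subsingleton ((LDF I).h (k+1) N) := by
  have : ∀ x : (LDF I).h (k+1) N, x = 0 := by
    intro z
    obtain ⟨n, x, rfl⟩ := lc_exists z
    let S := SES.ofSub (I ^ n)
    obtain ⟨e', rfl⟩ := proj_shift S x
    obtain ⟨m, hm⟩ := key_torsion I N hN k _ e'
    let S' := SES.ofSub (I ^ (m + n))
    have hle : I ^ (m + n) ≤ I ^ n := Ideal.pow_le_pow_right (by lia)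
    rw [← lcOf_tr (show n ≤ m + n by lia)]
    have h1 := ses_nat_comp S' S (Submodule.inclusion hle) LinearMap.id
      (Submodule.mapQ (I ^ (m + n)) (I ^ n) LinearMap.id hle) rfl rfl e'
    have h2 : extPre (qmap I (show n ≤ m + n by lia)) (ModuleCat.of R N) (k+1)
      (S.se.extClass.comp e' (add_comm 1 k)) = 0 := by
      refine h1.trans ?_
      rw [hm, Abelian.Ext.comp_zero]
      intro y
      have h3 : y.1 ∈ I ^ m • I ^ n := by
        rw [smul_eq_mul, ← pow_add]
        exact y.2
      have h4 : I ^ m • I ^ n = Submodule.map (I ^ n).subtype (I ^ m • ⊤) := by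
        rw [Submodule.map_smul'', Submodule.map_top, Submodule.range_subtype]
      rw [h4] at h3
      obtain ⟨z, hz, hzy⟩ := h3
      have : z = Submodule.inclusion hle y := Subtype.ext hzy
      rwa [← this]
    exact (congrArg _ h2).trans (map_zero _)
  exact ⟨fun x y => by rw [this x, this y]⟩

noncomputable def preExt (S : SES f g) (N : ModuleCat.{u} R) (k : ℕ) :
    Abelian.Ext (ModuleCat.of R A) N k →ₗ[R] Abelian.Ext (ModuleCat.of R C) N (k+1) where
  toFun e := S.se.extClass.comp e (add_comm 1 k)
  map_add' x y := by simp
  map_smul' r x := by simp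

lemma ext_artinian (N : Type u) [AddCommGroup N] [Module R N] [IsArtinian R N] (k : ℕ) :
    ∀ (L : Type u) [AddCommGroup L] [Module R L] [Module.Finite R L],
      IsArtinian R (Abelian.Ext (ModuleCat.of R L) (ModuleCat.of R N) k) := by
  induction k with
  | zero =>
    intro L _ _ _
    obtain ⟨n, π, hπ⟩ := Module.Finite.exists_fin' R L
    let φ : (L →ₗ[R] N) →ₗ[R] (Fin n → N) :=
      LinearMap.pi (fun j => LinearMap.applyₗ (π (Pi.single j 1)))
    have hφ : Function.Injective φ := by
      rw [injective_iff_map_eq_zero]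
      intro a ha
      have : a ∘ₗ π = 0 := by
        apply LinearMap.pi_ext'
        intro j
        ext
        exact congrFun ha j
      ext y
      obtain ⟨x, rfl⟩ := hπ y
      exact congrArg (fun t => t x) this
    have h1 : IsArtinian R (L →ₗ[R] N) := isArtinian_of_injective φ hφ
    exact isArtinian_of_linearEquiv (Abelian.Ext.linearEquiv₀.trans ModuleCat.homLinearEquiv).symm
  | succ k ih =>
    intro L _ _ _
    obtain ⟨F, _, _, _, _, π, hπ⟩ := Module.exists_finite_presentation R L
    let S := SES.ofSurj π hπ
    have := ih (LinearMap.ker π)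
    exact isArtinian_of_surjective _ (preExt S (ModuleCat.of R N) k) (fun e => proj_shift S e)

end FF

section GG
variable {R : Type u} [CommRing R]

lemma itor_of_gen (s : Finset R) (N : Type u) [AddCommGroup N] [Module R N] (x : N)
    (h : ∀ a ∈ s, ∃ n : ℕ, a ^ n • x = 0) :
    ∃ n : ℕ, ∀ r ∈ (Ideal.span (s : Set R)) ^ n, r • x = 0 := by
  have h1 : Ideal.span (s : Set R) ≤ Ideal.radical (LinearMap.ker (LinearMap.toSpanSingleton R N x)) := by
    rw [Ideal.span_le]
    intro a ha
    obtain ⟨n, hn⟩ := h a ha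
    exact ⟨n, by simpa using hn⟩
  obtain ⟨n, hn⟩ := Ideal.exists_pow_le_of_le_radical_of_fg h1 ⟨s, rfl⟩
  exact ⟨n, fun r hr => by simpa using hn hr⟩

lemma loc_ker (a : R) (N : Type u) [AddCommGroup N] [Module R N] (x : N)
    (h : LocalizedModule.mkLinearMap (Submonoid.powers a) N x = 0) : ∃ n : ℕ, a ^ n • x = 0 := by
  rw [IsLocalizedModule.eq_zero_iff (Submonoid.powers a)] at h
  obtain ⟨⟨_, n, rfl⟩, h⟩ := h
  exact ⟨n, h⟩

lemma loc_coker (a : R) (N : Type u) [AddCommGroup N] [Module R N]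
    (x : LocalizedModule (Submonoid.powers a) N) :
    ∃ n : ℕ, ∃ y, a ^ n • x = LocalizedModule.mkLinearMap (Submonoid.powers a) N y := by
  obtain ⟨⟨y, ⟨_, n, rfl⟩⟩, h⟩ :=
    IsLocalizedModule.surj (Submonoid.powers a) (LocalizedModule.mkLinearMap (Submonoid.powers a) N) x
  exact ⟨n, y, h⟩

variable [IsNoetherianRing R] (I : Ideal R)

lemma exists_emb (N : Type u) [AddCommGroup N] [Module R N] (hN : Gam I N = ⊥) :
    ∃ (B : Type u) (_ : AddCommGroup B) (_ : Module R B) (f : N →ₗ[R] B), Function.Injective f ∧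
      (∀ i, Subsingleton ((LDF I).h i B)) ∧ (∀ i, Subsingleton ((EI I).h i B)) := by
  obtain ⟨s, rfl⟩ := (isNoetherian_def.1 ‹IsNoetherianRing R›) I
  refine ⟨∀ j : s, LocalizedModule (Submonoid.powers j.1) N, inferInstance, inferInstance,
    LinearMap.pi (fun j => LocalizedModule.mkLinearMap _ N), ?_, fun i => ?_, fun i => ?_⟩
  · rw [injective_iff_map_eq_zero]
    intro x hx
    have h1 := itor_of_gen s N x (fun a ha => loc_ker a N x (congrFun hx ⟨a, ha⟩))
    have h2 : x ∈ Gam (Ideal.span (s : Set R)) N := h1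
    have hN' : Gam (Ideal.span (s : Set R)) N = ⊥ := hN
    rw [hN'] at h2
    simpa using h2
  · exact DF.zero_pi _ i _ (fun j => DF.zero_loc _ (LDF_tor (Ideal.subset_span j.2)) i)
  · exact DF.zero_pi _ i _ (fun j => DF.zero_loc _ (EI_tor (Ideal.subset_span j.2)) i)

lemma lc_vanish_aux (s t : Finset R) (hts : t ⊆ s) :
    ∀ (N : Type u) [AddCommGroup N] [Module R N],
      (∀ a ∈ s, a ∉ t → ∀ x : N, ∃ n : ℕ, a ^ n • x = 0) → ∀ i, t.card < i →
        Subsingleton ((LDF (Ideal.span (s : Set R))).h i N) := by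
  classical
  induction t using Finset.induction_on with
  | empty =>
    intro N _ _ h i hi
    obtain ⟨k, rfl⟩ : ∃ k, i = k + 1 := ⟨i - 1, by simp at hi; lia⟩
    exact lc_torsion_zero _ N (fun x => itor_of_gen s N x (fun a ha => h a ha (by simp) x)) k
  | insert a t ha ih =>
    intro N _ _ h i hi
    rw [Finset.card_insert_of_notMem ha] at hi
    obtain ⟨k, rfl⟩ : ∃ k, i = k + 1 := ⟨i - 1, by lia⟩
    have ih' := ih ((Finset.subset_insert a t).trans hts)
    have has : a ∈ s := hts (Finset.mem_insert_self a t)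
    let f := LocalizedModule.mkLinearMap (Submonoid.powers a) N
    have h1 : Subsingleton ((LDF (Ideal.span (s : Set R))).h (k+1) (LinearMap.ker f)) := by
      refine ih' _ ?_ _ (by lia)
      rintro b hb hbt ⟨x, hx⟩
      by_cases hab : b = a
      · subst hab
        obtain ⟨n, hn⟩ := loc_ker b N x hx
        exact ⟨n, Subtype.ext hn⟩
      · obtain ⟨n, hn⟩ := h b hb (by simp [hab, hbt]) x
        exact ⟨n, Subtype.ext hn⟩
    have h2 : Subsingleton ((LDF (Ideal.span (s : Set R))).h k (_ ⧸ LinearMap.range f)) := by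
      refine ih' _ ?_ _ (by lia)
      intro b hb hbt x
      obtain ⟨x, rfl⟩ := Submodule.mkQ_surjective _ x
      obtain ⟨n, y, hy⟩ := loc_coker a N x
      by_cases hab : b = a
      · subst hab
        refine ⟨n, ?_⟩
        rw [← map_smul, hy, Submodule.mkQ_apply, Submodule.Quotient.mk_eq_zero]
        exact ⟨y, rfl⟩
      · obtain ⟨m, hm⟩ := h b hb (by simp [hab, hbt]) y
        refine ⟨m, ?_⟩
        have h3 : a ^ n • b ^ m • x = 0 := by
          rw [smul_comm, hy, ← map_smul, hm, map_zero]
        have h4 : b ^ m • x = 0 := by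
          have hu := IsLocalizedModule.map_units f (⟨a ^ n, ⟨n, rfl⟩⟩ : Submonoid.powers a)
          rw [Module.End.isUnit_iff] at hu
          exact hu.1 (h3.trans (map_zero _).symm)
        rw [← map_smul, h4, map_zero]
    have h3 : Subsingleton ((LDF (Ideal.span (s : Set R))).h (k+1)
        (LocalizedModule (Submonoid.powers a) N)) :=
      DF.zero_loc _ (LDF_tor (Ideal.subset_span has)) (k+1)
    have h4 : Subsingleton ((LDF (Ideal.span (s : Set R))).h (k+1) (LinearMap.range f)) :=
      DF.sub_of_rk _ _ (DF.ex₁ (LDF (Ideal.span (s : Set R))) k (SES.ofSub (LinearMap.range f)))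
    have S : SES (LinearMap.ker f).subtype f.rangeRestrict := by
      have := SES.ofSurj f.rangeRestrict f.surjective_rangeRestrict
      refine ⟨Submodule.injective_subtype _, ?_, this.surj⟩
      rw [LinearMap.exact_iff]
      simp
    exact DF.sub_of_rk _ _ (DF.ex₂ (LDF (Ideal.span (s : Set R))) (k+1) S)

lemma lc_vanish : ∃ d : ℕ, ∀ (N : Type u) [AddCommGroup N] [Module R N] (i : ℕ), d < i →
    Subsingleton ((LDF I).h i N) := by
  obtain ⟨s, rfl⟩ := (isNoetherian_def.1 ‹IsNoetherianRing R›) I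
  exact ⟨s.card, fun N _ _ i hi => lc_vanish_aux s s subset_rfl N (fun a h h' => (h' h).elim) i hi⟩

end GG

section HH
variable {R : Type u} [CommRing R]

open TensorProduct in
lemma exists_map_prime (M : Type u) [AddCommGroup M] [Module R M] [Module.Finite R M]
    (p : PrimeSpectrum R) (hp : Module.annihilator R M ≤ p.asIdeal) :
    ∃ φ : M →ₗ[R] R ⧸ p.asIdeal, φ ≠ 0 := by
  have h1 : p ∈ Module.support R M := Module.mem_support_iff_of_finite.mpr hp
  rw [Module.mem_support_iff_nontrivial_residueField_tensorProduct] at h1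
  obtain ⟨v, hv⟩ := exists_ne (0 : p.asIdeal.ResidueField ⊗[R] M)
  obtain ⟨l, hl⟩ : ∃ l : Module.Dual p.asIdeal.ResidueField (p.asIdeal.ResidueField ⊗[R] M),
      l v ≠ 0 := by
    by_contra! h
    exact hv ((Module.forall_dual_apply_eq_zero_iff p.asIdeal.ResidueField v).1 h)
  let ψ : M →ₗ[R] p.asIdeal.ResidueField :=
    (l.restrictScalars R) ∘ₗ TensorProduct.mk R p.asIdeal.ResidueField M 1
  obtain ⟨m, hm⟩ : ∃ m, ψ m ≠ 0 := by
    by_contra! h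
    apply hl
    induction v using TensorProduct.induction_on with
    | zero => simp
    | tmul c m =>
      have : c ⊗ₜ[R] m = c • (1 : p.asIdeal.ResidueField) ⊗ₜ[R] m := by
        rw [TensorProduct.smul_tmul', smul_eq_mul, mul_one]
      rw [this, map_smul]
      exact (congrArg _ (h m)).trans (smul_zero _)
    | add x y hx hy =>
      have h0 : ∀ z : p.asIdeal.ResidueField ⊗[R] M, l z = 0 := by
        intro z
        induction z using TensorProduct.induction_on with
        | zero => simp
        | tmul c m =>
          have : c ⊗ₜ[R] m = c • (1 : p.asIdeal.ResidueField) ⊗ₜ[R] m := by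
            rw [TensorProduct.smul_tmul', smul_eq_mul, mul_one]
          rw [this, map_smul]
          exact (congrArg _ (h m)).trans (smul_zero _)
        | add x y hx hy => rw [map_add, hx, hy, add_zero]
      exact h0 _
  obtain ⟨s, hs⟩ := (Module.Finite.fg_top : (⊤ : Submodule R M).FG)
  classical
  obtain ⟨b, hb⟩ := IsLocalization.exist_integer_multiples_of_finset
    (nonZeroDivisors (R ⧸ p.asIdeal)) (s.image ψ)
  let θ : (R ⧸ p.asIdeal) →ₗ[R] p.asIdeal.ResidueField :=
    (Algebra.linearMap (R ⧸ p.asIdeal) p.asIdeal.ResidueField).restrictScalars R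
  have hθ : Function.Injective θ := IsFractionRing.injective (R ⧸ p.asIdeal) p.asIdeal.ResidueField
  obtain ⟨b', hb'⟩ := Ideal.Quotient.mk_surjective b.1
  have hbs : ∀ x : p.asIdeal.ResidueField, b' • x = b.1 • x := by
    intro x
    rw [← hb', Algebra.smul_def, Algebra.smul_def]
    rfl
  have hr : ∀ y, (b' • ψ) y ∈ LinearMap.range θ := by
    intro y
    have hy : y ∈ Submodule.span R (s : Set M) := hs ▸ Submodule.mem_top
    have hle : Submodule.span R (s : Set M) ≤ (LinearMap.range θ).comap (b' • ψ) := by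
      rw [Submodule.span_le]
      intro z hz
      obtain ⟨c, hc⟩ := hb (ψ z) (Finset.mem_image_of_mem _ hz)
      refine ⟨c, ?_⟩
      rw [LinearMap.smul_apply, hbs]
      exact hc
    exact hle hy
  let e := LinearEquiv.ofInjective θ hθ
  refine ⟨e.symm.toLinearMap ∘ₗ (b' • ψ).codRestrict _ hr, fun h0 => hm ?_⟩
  have h2 : e.symm ((b' • ψ).codRestrict _ hr m) = 0 := congrArg (fun t => t m) h0
  rw [LinearEquiv.map_eq_zero_iff] at h2
  have h3 : b' • ψ m = 0 := congrArg Subtype.val h2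
  rw [hbs, Algebra.smul_def, mul_eq_zero] at h3
  refine h3.resolve_left ?_
  exact fun h4 => nonZeroDivisors.ne_zero b.2 (hθ (h4.trans (map_zero _).symm))

lemma DF.artin_mid {A B C : Type u} [AddCommGroup A] [Module R A] [AddCommGroup B] [Module R B]
    [AddCommGroup C] [Module R C] {f : A →ₗ[R] B} {g : B →ₗ[R] C} (D : DF R) (i : ℕ) (S : SES f g)
    (h1 : IsArtinian R (D.h i A)) (h2 : IsArtinian R (D.h i C)) : IsArtinian R (D.h i B) :=
  isArtinian_of_range_eq_ker _ _ (D.ex₂ i S)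

variable [IsNoetherianRing R] (I : Ideal R)

lemma artin_step (M : Type u) [AddCommGroup M] [Module R M] [Module.Finite R M] (i : ℕ)
    (hM : IsArtinian R ((LDF I).h i M))
    (hP : ∀ (N : Type u) [AddCommGroup N] [Module R N] [Module.Finite R N],
      Module.annihilator R M ≤ Module.annihilator R N → IsArtinian R ((LDF I).h (i+1) N))
    (N : Type u) [AddCommGroup N] [Module R N] [hfN : Module.Finite R N]
    (hMN : Module.annihilator R M ≤ Module.annihilator R N) : IsArtinian R ((LDF I).h i N) := by
  have key : ∀ a : Ideal R, Module.annihilator R M ≤ a → ∀ (N : Type u) [AddCommGroup N] [Module R N]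
      [Module.Finite R N], a ≤ Module.annihilator R N → IsArtinian R ((LDF I).h i N) := by
    intro a
    induction a using IsNoetherian.induction with
    | hgt a IH =>
    intro hMa N _ _ hfN
    refine IsNoetherianRing.induction_on_isQuotientEquivQuotientPrime R hfN
      (motive := fun N _ _ _ => a ≤ Module.annihilator R N → IsArtinian R ((LDF I).h i N)) ?_ ?_ ?_
    · intro N _ _ _ _ _
      have : Subsingleton ((LDF I).h i N) := by
        have h0 : ∀ x : (LDF I).h i N, x = 0 := by
          intro x
          rw [← (LDF I).mp_id i x, Subsingleton.elim (LinearMap.id : N →ₗ[R] N) 0, (LDF I).mp_zero]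
        exact ⟨fun x y => by rw [h0 x, h0 y]⟩
      infer_instance
    · intro N _ _ _ p e ha
      refine @isArtinian_of_linearEquiv _ _ _ _ _ _ _ _ ((LDF I).mpe i e.symm) ?_
      rw [e.annihilator_eq, Ideal.annihilator_quotient] at ha
      rcases ha.lt_or_eq with h | h
      · exact IH _ h (hMa.trans h.le) _ (by rw [Ideal.annihilator_quotient])
      · obtain ⟨φ, hφ⟩ := exists_map_prime M p (h ▸ hMa)
        have h1 : IsArtinian R ((LDF I).h (i+1) (LinearMap.ker φ)) :=
          hP _ (LinearMap.annihilator_le_of_injective _ (Submodule.injective_subtype _))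
        have S1 : SES (LinearMap.ker φ).subtype φ.rangeRestrict := by
          refine ⟨Submodule.injective_subtype _, ?_, φ.surjective_rangeRestrict⟩
          rw [LinearMap.exact_iff]
          simp
        have h2 : IsArtinian R ((LDF I).h i (LinearMap.range φ)) :=
          isArtinian_of_range_eq_ker _ _ ((LDF I).ex₃ i S1)
        refine (LDF I).artin_mid i (SES.ofSub (LinearMap.range φ)) h2 ?_
        let J : Ideal R := (LinearMap.range φ).comap (Submodule.mkQ p.asIdeal)
        have hpJ : a ≤ J := by
          rw [h]
          intro x hx
          have : Submodule.mkQ p.asIdeal x = 0 := by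
            rwa [Submodule.mkQ_apply, Submodule.Quotient.mk_eq_zero]
          change Submodule.mkQ p.asIdeal x ∈ LinearMap.range φ
          rw [this]
          exact zero_mem _
        refine IH J (lt_of_le_of_ne hpJ ?_) (hMa.trans hpJ) _ ?_
        · intro haJ
          apply hφ
          ext m
          obtain ⟨x, hx⟩ := Submodule.mkQ_surjective _ (φ m)
          have : x ∈ J := by
            change Submodule.mkQ p.asIdeal x ∈ LinearMap.range φ
            rw [hx]
            exact ⟨m, rfl⟩
          rw [← haJ, h] at this
          rw [← hx, LinearMap.zero_apply, Submodule.mkQ_apply, Submodule.Quotient.mk_eq_zero]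
          exact this
        · intro r hr
          rw [Module.mem_annihilator]
          intro y
          obtain ⟨y, rfl⟩ := Submodule.mkQ_surjective _ y
          obtain ⟨y, rfl⟩ := Submodule.mkQ_surjective _ y
          rw [← map_smul, Submodule.mkQ_apply, Submodule.Quotient.mk_eq_zero, ← map_smul]
          exact J.mul_mem_right y hr
    · intro N₁ _ _ _ N₂ _ _ _ N₃ _ _ _ f g hf hg hfg m1 m3 ha
      exact (LDF I).artin_mid i ⟨hf, hfg, hg⟩ (m1 (ha.trans (LinearMap.annihilator_le_of_injective f hf)))
        (m3 (ha.trans (LinearMap.annihilator_le_of_surjective g hg)))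
  exact key _ le_rfl N hMN

lemma artin_all (M : Type u) [AddCommGroup M] [Module R M] [Module.Finite R M]
    (hM : ∀ i, 2 ≤ i → IsArtinian R ((LDF I).h i M)) (i : ℕ) (hi : 2 ≤ i)
    (N : Type u) [AddCommGroup N] [Module R N] [Module.Finite R N]
    (hMN : Module.annihilator R M ≤ Module.annihilator R N) : IsArtinian R ((LDF I).h i N) := by
  obtain ⟨d, hd⟩ := lc_vanish I
  have : ∀ k i, 2 ≤ i → d < i + k → ∀ (N : Type u) [AddCommGroup N] [Module R N] [Module.Finite R N],
      Module.annihilator R M ≤ Module.annihilator R N → IsArtinian R ((LDF I).h i N) := by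
    intro k
    induction k with
    | zero =>
      intro i _ hi N _ _ _ _
      have := hd N i hi
      infer_instance
    | succ k ih =>
      intro i h2 hi N _ _ _ hN
      exact artin_step I M i (hM i h2) (ih (i+1) (by lia) (by lia)) N hN
  exact this (d+1) i hi (by lia) N hMN
end HH

section JJ
variable {R : Type u} [CommRing R]
variable {A B C : Type u} [AddCommGroup A] [Module R A] [AddCommGroup B] [Module R B]
    [AddCommGroup C] [Module R C]

lemma SES.ofRange (f : A →ₗ[R] B) : SES (LinearMap.ker f).subtype f.rangeRestrict := by
  refine ⟨Submodule.injective_subtype _, ?_, f.surjective_rangeRestrict⟩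
  rw [LinearMap.exact_iff]
  simp

/-- lifting through a short exact sequence, from an ideal -/
lemma lift_of_ses {f : A →ₗ[R] B} {g : B →ₗ[R] C} (S : SES f g) (J : Ideal R) (θ : J →ₗ[R] C)
    (h : (SES.ofSub J).se.extClass.comp
      ((Abelian.Ext.mk₀ (ModuleCat.ofHom θ)).comp S.se.extClass (zero_add 1)) (add_comm 1 1) = 0) :
    ∃ φ : J →ₗ[R] B, g ∘ₗ φ = θ := by
  obtain ⟨e', he'⟩ := Abelian.Ext.contravariant_sequence_exact₁ (SES.ofSub J).se _ _ (add_comm 1 1) h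
  have : Projective (SES.ofSub J).sc.X₂ := (IsProjective.iff_projective R).1 inferInstance
  rw [Abelian.Ext.eq_zero_of_projective e', Abelian.Ext.comp_zero] at he'
  obtain ⟨y, hy⟩ := Abelian.Ext.covariant_sequence_exact₃ _ S.se _ (zero_add 1) he'.symm
  obtain ⟨φ, rfl⟩ := Abelian.Ext.mk₀_bijective _ _ |>.2 y
  rw [Abelian.Ext.mk₀_comp_mk₀] at hy
  have h2 := (Abelian.Ext.mk₀_bijective _ _).1 hy
  exact ⟨φ.hom, congrArg ModuleCat.Hom.hom h2⟩

noncomputable def alph (s : Finset R) (A : Type u) [AddCommGroup A] [Module R A] : (s → A) →ₗ[R] A :=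
  ∑ j : s, (j.1 • LinearMap.proj j)

lemma alph_apply (s : Finset R) (v : s → A) : alph s A v = ∑ j : s, j.1 • v j := by
  simp [alph]

variable [IsNoetherianRing R] (I : Ideal R)

lemma key_ideal (M : Type u) [AddCommGroup M] [Module R M] [Module.Finite R M]
    (hM : ∀ i, 2 ≤ i → IsArtinian R ((LDF I).h i M)) (s : Finset R) (hs : Ideal.span (s : Set R) = I) :
    ∃ c : Ideal R, IsArtinian R (R ⧸ c) ∧ ∀ r ∈ c, ∃ n : ℕ,
      ∃ φ : (I ^ n : Ideal R) →ₗ[R] (s → R ⧸ Module.annihilator R M),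
        ∀ x, alph s _ (φ x) = r • Submodule.mkQ (Module.annihilator R M) x.1 := by
  classical
  let α := alph s (R ⧸ Module.annihilator R M)
  let S := SES.ofRange α
  have hι : ∀ x : (I ^ 1 : Ideal R), (Submodule.mkQ (Module.annihilator R M) ∘ₗ Submodule.subtype _) x
      ∈ LinearMap.range α := by
    rintro ⟨x, hx⟩
    rw [pow_one, ← hs] at hx
    change Submodule.mkQ (Module.annihilator R M) x ∈ LinearMap.range α
    have hle : Ideal.span (s : Set R) ≤ (LinearMap.range α).comap (Submodule.mkQ (Module.annihilator R M)) := ?_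
    · exact hle hx
    rw [Ideal.span_le]
    intro a ha
    refine ⟨Pi.single ⟨a, ha⟩ (Submodule.mkQ _ 1), ?_⟩
    change alph s _ _ = _
    rw [alph_apply, Finset.sum_eq_single ⟨a, ha⟩]
    · rw [Pi.single_eq_same, ← map_smul, smul_eq_mul, mul_one]
    · intro b _ hb
      rw [Pi.single_eq_of_ne hb, smul_zero]
    · simp
  let ι : (I ^ 1 : Ideal R) →ₗ[R] LinearMap.range α :=
    (Submodule.mkQ (Module.annihilator R M) ∘ₗ Submodule.subtype _).codRestrict _ hι
  let ε := (Abelian.Ext.mk₀ (ModuleCat.ofHom ι)).comp S.se.extClass (zero_add 1)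
  let ξ : Abelian.Ext (Qn I 1) (ModuleCat.of R (LinearMap.ker α)) 2 :=
    (SES.ofSub (I ^ 1)).se.extClass.comp ε (add_comm 1 1)
  let z : (LDF I).h 2 (LinearMap.ker α) := lcOf I 2 _ 1 ξ
  have hA : IsArtinian R ((LDF I).h 2 (LinearMap.ker α)) := by
    refine artin_all I M hM 2 le_rfl _ ?_
    intro r hr
    rw [Module.mem_annihilator]
    intro y
    apply Subtype.ext
    funext j
    obtain ⟨t, ht⟩ := Submodule.mkQ_surjective _ (y.1 j)
    change r • y.1 j = 0
    rw [← ht, ← map_smul, Submodule.mkQ_apply, Submodule.Quotient.mk_eq_zero]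
    exact Ideal.mul_mem_right _ _ hr
  refine ⟨LinearMap.ker (LinearMap.toSpanSingleton R _ z), ?_, ?_⟩
  · exact isArtinian_of_injective
      ((LinearMap.ker (LinearMap.toSpanSingleton R _ z)).liftQ _ le_rfl)
      (LinearMap.ker_eq_bot.1 (Submodule.ker_liftQ_eq_bot _ _ _ le_rfl))
  · intro r hr
    have hr' : r • z = 0 := by simpa using hr
    have hr2 : lcOf I 2 _ 1 (r • ξ) = 0 := by rw [map_smul]; exact hr'
    obtain ⟨n, hn, h0⟩ := lc_zero _ hr2
    rw [map_smul] at h0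
    have hle : I ^ n ≤ I ^ 1 := Ideal.pow_le_pow_right hn
    have h1 := ses_nat_comp (SES.ofSub (I ^ n)) (SES.ofSub (I ^ 1)) (Submodule.inclusion hle)
      LinearMap.id (Submodule.mapQ (I ^ n) (I ^ 1) LinearMap.id hle) rfl rfl ε
    have h2 : r • (SES.ofSub (I ^ n)).se.extClass.comp
      ((Abelian.Ext.mk₀ (ModuleCat.ofHom (Submodule.inclusion hle))).comp ε (zero_add 1)) (add_comm 1 1) = 0 := by
      rw [← h1]
      exact h0
    have h3 : (Abelian.Ext.mk₀ (ModuleCat.ofHom (Submodule.inclusion hle))).comp ε (zero_add 1) =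
      (Abelian.Ext.mk₀ (ModuleCat.ofHom (ι ∘ₗ Submodule.inclusion hle))).comp S.se.extClass (zero_add 1) := by
      change (Abelian.Ext.mk₀ _).comp ((Abelian.Ext.mk₀ _).comp _ _) _ = _
      rw [Abelian.Ext.mk₀_comp_mk₀_assoc]
      rfl
    obtain ⟨φ, hφ⟩ := lift_of_ses S (I ^ n) (r • (ι ∘ₗ Submodule.inclusion hle)) (by
      have h5 : ModuleCat.ofHom (r • (ι ∘ₗ Submodule.inclusion hle)) =
        r • ModuleCat.ofHom (ι ∘ₗ Submodule.inclusion hle) := rfl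
      rw [h5, Abelian.Ext.mk₀_smul, Abelian.Ext.smul_comp, ← h3, Abelian.Ext.comp_smul, h2])
    refine ⟨n, φ, fun x => ?_⟩
    have h6 := congrArg (fun t => (t x).1) hφ
    exact h6
end JJ

open scoped TensorProduct
section KK
variable {R : Type u} [CommRing R]

/-- action of R / Ann M on M -/
noncomputable def actq (M : Type u) [AddCommGroup M] [Module R M] :
    (R ⧸ Module.annihilator R M) →ₗ[R] (M →ₗ[R] M) :=
  (Module.annihilator R M).liftQ (LinearMap.lsmul R M) (by
    intro r hr
    ext m
    exact Module.mem_annihilator.1 hr m)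

lemma noeth_of_artin [IsNoetherianRing R] {E : Type u} [AddCommGroup E] [Module R E] [IsArtinian R E] (c : Ideal R)
    [IsArtinian R (R ⧸ c)] (h : ∀ r ∈ c, ∀ e : E, r • e = 0) : IsNoetherian R E := by
  have ht : Module.IsTorsionBySet R E (c : Set R) := fun e r => h r.1 r.2 e
  let := ht.module
  have : IsScalarTower R (R ⧸ c) E := ht.isScalarTower
  have : IsArtinianRing (R ⧸ c) := isArtinian_of_tower R inferInstance
  have : IsArtinian (R ⧸ c) E := isArtinian_of_tower R inferInstance
  have : IsNoetherian (R ⧸ c) E := IsSemiprimaryRing.isNoetherian_iff_isArtinian.2 inferInstance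
  have : Module.Finite R E := Module.Finite.trans (R ⧸ c) E
  infer_instance

variable (I : Ideal R)

noncomputable def mul0 (n : ℕ) (M : Type u) [AddCommGroup M] [Module R M] :
    (I ^ n : Ideal R) ⊗[R] M →ₗ[R] M :=
  TensorProduct.lift (LinearMap.lsmul R M ∘ₗ Submodule.subtype _)

lemma mul0_tmul (n : ℕ) (M : Type u) [AddCommGroup M] [Module R M] (x : (I ^ n : Ideal R)) (m : M) :
    mul0 I n M (x ⊗ₜ m) = x.1 • m := rfl

lemma mul0_ker (n : ℕ) (M : Type u) [AddCommGroup M] [Module R M] :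
    ITor I (LinearMap.ker (mul0 I n M)) := by
  rintro ⟨z, hz⟩
  refine ⟨n, fun r hr => Subtype.ext ?_⟩
  change r • z = 0
  have key : ∀ z, r • z = (⟨r, hr⟩ : (I ^ n : Ideal R)) ⊗ₜ[R] mul0 I n M z := by
    intro z
    induction z using TensorProduct.induction_on with
    | zero => simp
    | tmul x m =>
      rw [mul0_tmul, TensorProduct.smul_tmul', ← TensorProduct.smul_tmul]
      congr 1
      apply Subtype.ext
      exact mul_comm _ _
    | add x y hx hy => rw [smul_add, hx, hy, map_add, TensorProduct.tmul_add]
  rw [key, hz, TensorProduct.tmul_zero]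

lemma mul0_coker (n : ℕ) (M : Type u) [AddCommGroup M] [Module R M] :
    ITor I (M ⧸ LinearMap.range (mul0 I n M)) := by
  intro z
  obtain ⟨z, rfl⟩ := Submodule.mkQ_surjective _ z
  refine ⟨n, fun r hr => ?_⟩
  rw [← map_smul, Submodule.mkQ_apply, Submodule.Quotient.mk_eq_zero]
  exact ⟨⟨r, hr⟩ ⊗ₜ z, rfl⟩

variable [IsNoetherianRing R]

lemma bij_of_tor {A B : Type u} [AddCommGroup A] [Module R A] [AddCommGroup B] [Module R B]
    (f : A →ₗ[R] B) (h1 : ITor I (LinearMap.ker f)) (h2 : ITor I (B ⧸ LinearMap.range f))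
    (i : ℕ) (hi : 2 ≤ i) : Function.Bijective ((LDF I).mp i f) := by
  obtain ⟨k, rfl⟩ : ∃ k, i = k + 1 + 1 := ⟨i - 2, by lia⟩
  have ha : Function.Bijective ((LDF I).mp (k+1+1) f.rangeRestrict) :=
    ⟨(LDF I).g_inj _ (SES.ofRange f) (lc_torsion_zero I _ h1 _),
      (LDF I).g_surj _ (SES.ofRange f) (lc_torsion_zero I _ h1 _)⟩
  have hb : Function.Bijective ((LDF I).mp (k+1+1) (LinearMap.range f).subtype) :=
    ⟨(LDF I).f_inj _ (SES.ofSub _) (lc_torsion_zero I _ h2 _),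
      (LDF I).f_surj _ (SES.ofSub _) (lc_torsion_zero I _ h2 _)⟩
  have hd : (LinearMap.range f).subtype ∘ₗ f.rangeRestrict = f := rfl
  have hc : ⇑((LDF I).mp (k+1+1) f) =
      (LDF I).mp (k+1+1) (LinearMap.range f).subtype ∘ (LDF I).mp (k+1+1) f.rangeRestrict := by
    funext x
    rw [Function.comp_apply, (LDF I).mp_comp, hd]
  rw [hc]
  exact hb.comp ha

lemma ext_lc_noeth (M : Type u) [AddCommGroup M] [Module R M] [Module.Finite R M]
    (hM : ∀ i, 2 ≤ i → IsArtinian R ((LDF I).h i M)) (i : ℕ) (hi : 2 ≤ i) (j : ℕ) :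
    IsNoetherian R ((EI I).h j ((LDF I).h i M)) := by
  classical
  obtain ⟨s, hs⟩ := (isNoetherian_def.1 ‹IsNoetherianRing R›) I
  obtain ⟨c, hc, hcr⟩ := key_ideal I M hM s hs
  have hAr := hM i hi
  have hE : IsArtinian R ((EI I).h j ((LDF I).h i M)) := ext_artinian _ j _
  refine noeth_of_artin c ?_
  intro r hr e
  obtain ⟨n, φ, hφ⟩ := hcr r hr
  let φ' : s → ((I ^ n : Ideal R) ⊗[R] M →ₗ[R] M) := fun k =>
    TensorProduct.lift (actq M ∘ₗ LinearMap.proj k ∘ₗ φ)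
  have h1 : r • mul0 I n M = ∑ k : s, k.1 • φ' k := by
    apply TensorProduct.ext'
    intro x m
    have h2 := congrArg (fun t => actq M t m) (hφ x)
    simp only [alph_apply, map_sum, map_smul, LinearMap.sum_apply, LinearMap.smul_apply] at h2
    rw [LinearMap.sum_apply]
    exact h2.symm
  have hb := bij_of_tor I (mul0 I n M) (mul0_ker I n M) (mul0_coker I n M) i hi
  let μ := LinearEquiv.ofBijective _ hb
  let t : s → ((LDF I).h i M →ₗ[R] (LDF I).h i M) := fun k =>
    (LDF I).mp i (φ' k) ∘ₗ μ.symm.toLinearMap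
  have h3 : r • (LinearMap.id : (LDF I).h i M →ₗ[R] (LDF I).h i M) = ∑ k : s, k.1 • t k := by
    ext y
    obtain ⟨x, rfl⟩ := μ.surjective y
    rw [LinearMap.sum_apply, LinearMap.smul_apply, LinearMap.id_apply]
    change r • (LDF I).mp i (mul0 I n M) x = _
    rw [← (LDF I).mp_smul, h1, (LDF I).mp_sum]
    refine Finset.sum_congr rfl fun k _ => ?_
    rw [(LDF I).mp_smul]
    simp [t]
  rw [← (EI I).mp_id j e, ← (EI I).mp_smul, h3, (EI I).mp_sum]
  refine Finset.sum_eq_zero fun k _ => ?_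
  rw [(EI I).mp_smul]
  exact EI_smul (hs ▸ Ideal.subset_span k.2) _
end KK

section LL
variable {R : Type u} [CommRing R] [IsNoetherianRing R]

lemma ext_noeth (N : Type u) [AddCommGroup N] [Module R N] [IsNoetherian R N] (k : ℕ) :
    ∀ (L : Type u) [AddCommGroup L] [Module R L] [Module.Finite R L],
      IsNoetherian R (Abelian.Ext (ModuleCat.of R L) (ModuleCat.of R N) k) := by
  induction k with
  | zero =>
    intro L _ _ _
    have h1 : IsNoetherian R (L →ₗ[R] N) := inferInstance
    exact isNoetherian_of_linearEquiv (Abelian.Ext.linearEquiv₀.trans ModuleCat.homLinearEquiv).symm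
  | succ k ih =>
    intro L _ _ _
    obtain ⟨F, _, _, _, _, π, hπ⟩ := Module.exists_finite_presentation R L
    let S := SES.ofSurj π hπ
    have := ih (LinearMap.ker π)
    exact isNoetherian_of_surjective (preExt S (ModuleCat.of R N) k)
      (LinearMap.range_eq_top.2 (fun e => proj_shift S e))

variable (I : Ideal R)

noncomputable def lcBar (N : Type u) [AddCommGroup N] [Module R N] (i : ℕ) :
    (LDF I).h (i+1) N ≃ₗ[R] (LDF I).h (i+1) (N ⧸ Gam I N) :=
  LinearEquiv.ofBijective ((LDF I).mp (i+1) (Gam I N).mkQ)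
    ⟨(LDF I).g_inj _ (SES.ofSub _) (lc_torsion_zero I _ (Gam_ITor I N) _),
      (LDF I).g_surj _ (SES.ofSub _) (lc_torsion_zero I _ (Gam_ITor I N) _)⟩

lemma exists_shift (N : Type u) [AddCommGroup N] [Module R N] :
    ∃ (B : Type u) (_ : AddCommGroup B) (_ : Module R B),
      (∀ i, Nonempty ((LDF I).h i B ≃ₗ[R] (LDF I).h (i+1) N)) ∧
      (∀ j, Nonempty ((EI I).h j B ≃ₗ[R] (EI I).h (j+1) (N ⧸ Gam I N))) := by
  obtain ⟨B, _, _, f, hf, h1, h2⟩ := exists_emb I (N ⧸ Gam I N) (Gam_quot I N)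
  refine ⟨B ⧸ LinearMap.range f, inferInstance, inferInstance, fun i => ⟨?_⟩, fun j => ⟨?_⟩⟩
  · exact ((LDF I).dle i (SES.ofInj f hf) (h1 _) (h1 _)).trans (lcBar I N i).symm
  · exact (EI I).dle j (SES.ofInj f hf) (h2 _) (h2 _)

lemma noeth_of_lc (j : ℕ) : ∀ (N : Type u) [AddCommGroup N] [Module R N],
    (∀ i k, IsNoetherian R ((EI I).h k ((LDF I).h i N))) → IsNoetherian R ((EI I).h j N) := by
  induction j with
  | zero =>
    intro N _ _ h
    have h0 := h 0 0
    have h1 : IsNoetherian R ((EI I).h 0 (Gam I N)) :=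
      isNoetherian_of_linearEquiv ((EI I).mpe 0 (lcGam I N))
    have h2 := EI_zero I _ (Gam_quot I N)
    exact isNoetherian_of_range_eq_ker _ _ ((EI I).ex₂ 0 (SES.ofSub (Gam I N)))
  | succ j ih =>
    intro N _ _ h
    have h0 := h 0 (j+1)
    have h1 : IsNoetherian R ((EI I).h (j+1) (Gam I N)) :=
      isNoetherian_of_linearEquiv ((EI I).mpe (j+1) (lcGam I N))
    obtain ⟨B, _, _, hB1, hB2⟩ := exists_shift I N
    have h2 : IsNoetherian R ((EI I).h j B) := by
      apply ih
      intro i k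
      have h3 := h (i+1) k
      exact isNoetherian_of_linearEquiv ((EI I).mpe k (hB1 i).some.symm)
    have h4 : IsNoetherian R ((EI I).h (j+1) (N ⧸ Gam I N)) :=
      isNoetherian_of_linearEquiv (hB2 j).some
    exact isNoetherian_of_range_eq_ker _ _ ((EI I).ex₂ (j+1) (SES.ofSub (Gam I N)))

lemma main_noeth (M : Type u) [AddCommGroup M] [Module R M] [Module.Finite R M]
    (hM : ∀ i, 2 ≤ i → IsArtinian R ((LDF I).h i M)) (i j : ℕ) :
    IsNoetherian R ((EI I).h j ((LDF I).h i M)) := by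
  by_cases hi : 2 ≤ i
  · exact ext_lc_noeth I M hM i hi j
  obtain rfl | rfl : i = 0 ∨ i = 1 := by lia
  · have h1 : IsNoetherian R ((EI I).h j (Gam I M)) := ext_noeth _ j _
    exact isNoetherian_of_linearEquiv ((EI I).mpe j (lcGam I M).symm)
  · obtain ⟨B, _, _, hB1, hB2⟩ := exists_shift I M
    have h1 : ∀ j, IsNoetherian R ((EI I).h j B) := by
      intro j
      have : IsNoetherian R ((EI I).h (j+1) (M ⧸ Gam I M)) := ext_noeth _ (j+1) _
      exact isNoetherian_of_linearEquiv (hB2 j).some.symm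
    have h2 : ∀ j, IsNoetherian R ((EI I).h j (B ⧸ Gam I B)) := by
      intro j
      apply noeth_of_lc
      intro i k
      cases i with
      | zero =>
        have h3 := LDF_zero I _ (Gam_quot I B)
        exact ext_noeth _ k _
      | succ i =>
        have h3 := ext_lc_noeth I M hM (i+1+1) (by lia) k
        exact isNoetherian_of_linearEquiv
          ((EI I).mpe k ((hB1 (i+1)).some.symm.trans (lcBar I B i)))
    have h3 : IsNoetherian R ((EI I).h j (Gam I B)) := by
      cases j with
      | zero =>
        have := h1 0
        exact isNoetherian_of_injective _ ((EI I).ex₀ (SES.ofSub (Gam I B)))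
      | succ j =>
        have := h1 (j+1)
        have := h2 j
        exact isNoetherian_of_range_eq_ker _ _ ((EI I).ex₁ j (SES.ofSub (Gam I B)))
    exact isNoetherian_of_linearEquiv ((EI I).mpe j ((lcGam I B).symm.trans (hB1 0).some))

end LL

/-- Let `R` be a Noetherian ring and `I` an ideal of `R`.  Then for each
finitely generated `R`-module `M` with `q(I, M) ≤ 1`, i.e. such that `H^i_I(M)` is Artinian
for all `i ≥ 2`, the `R`-modules `H^i_I(M)` are `I`-cofinite for all `i ≥ 0`. -/
theorem isCofinite_of_q_le_one {R : Type u} [CommRing R] [IsNoetherianRing R] (I : Ideal R)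
    (M : ModuleCat.{u} R) (hfg : Module.Finite R M)
    (hq : ∀ i : ℕ, 2 ≤ i → IsArtinian R ((localCohomology I i).obj M)) :
    ∀ i : ℕ, IsCofinite I ((localCohomology I i).obj M) := by
  intro i
  have hM : ∀ i, 2 ≤ i → IsArtinian R ((LDF I).h i M) := by
    intro i hi
    have := hq i hi
    exact isArtinian_of_linearEquiv (lcEquiv I i M).symm
  refine ⟨?_, fun j => ?_⟩
  · rw [← (lcEquiv I i M).support_eq]
    exact lc_support
  · have h1 := main_noeth I M hM i j
    have h2 : IsNoetherian R ((EI I).h j ((localCohomology I i).obj M)) :=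
      isNoetherian_of_linearEquiv ((EI I).mpe j (lcEquiv I i M))
    have h3 : IsNoetherian R
        (((Ext R (ModuleCat.{u} R) j).obj (Opposite.op (ModuleCat.of R (R ⧸ I)))).obj
          ((localCohomology I i).obj M)) :=
      isNoetherian_of_linearEquiv (extCmp (ModuleCat.of R (R ⧸ I)) ((localCohomology I i).obj M) j).symm
    infer_instance
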